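/- Almost surely, limsup_{m→∞} G_m / log m = θ, where G_m := sup{k : T_m^k < T_{m+1}^1} is the maximal number of distinct sites that are simultaneously visited exactly m times before any site reaches m+1 visits, and θ = -1/log(1 - 2q). -/

import Mathlib

open MeasureTheory ProbabilityTheory Filter Set
open scoped ENNReal NNReal

variable {Ω : Type*}

/-- Partial sums of the steps: `S X n = X 0 + ⋯ + X (n-1)` (the walk started at `0`). -/
noncomputable def S (X : ℕ → Ω → ℤ) (n : ℕ) (ω : Ω) : ℤ :=
  ∑ i ∈ Finset.range n, X i ω

/-- The local time at site `z` up to time `n`: `ξ(z,n) = #{k : 0 < k ≤ n, S_k = z}`. -/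
noncomputable def localTime (X : ℕ → Ω → ℤ) (z : ℤ) (n : ℕ) (ω : Ω) : ℕ :=
  ((Finset.Icc 1 n).filter (fun k => S X k ω = z)).card

/-- The maximal local time `ξ(n) = max_{y ∈ ℤ} ξ(y,n)`. -/
noncomputable def maxLocalTime (X : ℕ → Ω → ℤ) (n : ℕ) (ω : Ω) : ℕ :=
  sSup (Set.range fun z : ℤ => localTime X z n ω)

/-- The set of favorite sites at time `n`: `K(n) = {z : ξ(z,n) = ξ(n)}`. -/
noncomputable def favSites (X : ℕ → Ω → ℤ) (n : ℕ) (ω : Ω) : Set ℤ :=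
  {z : ℤ | localTime X z n ω = maxLocalTime X n ω}

/-- The total local time at site `z`: `ξ(z,∞) = #{k > 0 : S_k = z}` (as an extended natural). -/
noncomputable def totalLocalTime (X : ℕ → Ω → ℤ) (z : ℤ) (ω : Ω) : ℕ∞ :=
  {k : ℕ | 0 < k ∧ S X k ω = z}.encard

/-- `X` is a sequence of i.i.d. steps with `P(X_i = 1) = p`, `P(X_i = -1) = q`. -/
def IsAsymmetricSRW [MeasurableSpace Ω] (P : Measure Ω) (X : ℕ → Ω → ℤ) (p q : ℝ) : Prop :=
  (∀ i, Measurable (X i)) ∧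
  iIndepFun X P ∧
  (∀ i, P {ω | X i ω = 1} = ENNReal.ofReal p) ∧
  (∀ i, P {ω | X i ω = -1} = ENNReal.ofReal q)

/-- `hitTime X m k` is `T_m^k`, the first time at which `k` distinct sites have each
been visited at least `m` times (`⊤` if there is no such time), with `T_m^0 = 0`. -/
noncomputable def hitTime (X : ℕ → Ω → ℤ) (m : ℕ) : ℕ → Ω → ℕ∞
  | 0, _ => 0
  | k + 1, ω =>
      sInf ((fun n : ℕ => (n : ℕ∞)) ''
        {n : ℕ | hitTime X m k ω < (n : ℕ∞) ∧ {z : ℤ | m ≤ localTime X z n ω}.ncard = k + 1})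

/-- `hitSite X m k` is `L_m^k = S_{T_m^k}`, the location of the `k`-th site whose local
time reaches `m`. -/
noncomputable def hitSite (X : ℕ → Ω → ℤ) (m k : ℕ) (ω : Ω) : ℤ :=
  S X (hitTime X m k ω).toNat ω

open scoped Classical in
/-- The event `A_m^k`: the walk does not hit `{L_m^1, …, L_m^{k-2}}` during
`[T_m^{k-1} + m/2, T_m^k ∧ T_{m+1}^1]` and does not hit `L_m^{k-1}` during
`(T_m^{k-1}, T_m^k ∧ T_{m+1}^1]`.  By convention `A_m^1` is the sure event. -/
noncomputable def Aevent (X : ℕ → Ω → ℤ) (m k : ℕ) : Set Ω :=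
  if k ≤ 1 then Set.univ
  else
    {ω | (∀ n : ℕ, 2 * hitTime X m (k - 1) ω + (m : ℕ∞) ≤ 2 * (n : ℕ∞) →
            (n : ℕ∞) ≤ min (hitTime X m k ω) (hitTime X (m + 1) 1 ω) →
            ∀ j : ℕ, 1 ≤ j → j ≤ k - 2 → S X n ω ≠ hitSite X m j ω) ∧
         (∀ n : ℕ, hitTime X m (k - 1) ω < (n : ℕ∞) →
            (n : ℕ∞) ≤ min (hitTime X m k ω) (hitTime X (m + 1) 1 ω) →
            S X n ω ≠ hitSite X m (k - 1) ω)}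

/-- The event `B_m^k = A_m^1 ∩ ⋯ ∩ A_m^k`. -/
noncomputable def Bevent (X : ℕ → Ω → ℤ) (m k : ℕ) : Set Ω :=
  ⋂ j ∈ Finset.Icc 1 k, Aevent X m j

/-- The event `C_m^k = {T_m^k < T_{m+1}^1}`, i.e. at some time there are exactly `k`
favorite sites, each with local time `m`. -/
noncomputable def Cevent (X : ℕ → Ω → ℤ) (m k : ℕ) : Set Ω :=
  {ω | hitTime X m k ω < hitTime X (m + 1) 1 ω}

/-- `G_m = sup{k : T_m^k < T_{m+1}^1}`, the maximal number of distinct sites whose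
local times reach `m` before any site reaches `m + 1` visits. -/
noncomputable def Gcount (X : ℕ → Ω → ℤ) (m : ℕ) (ω : Ω) : ℕ :=
  sSup {k : ℕ | hitTime X m k ω < hitTime X (m + 1) 1 ω}
namespace GW

abbrev Path := ℕ → Bool

def st (b : Bool) : ℤ := if b then 1 else -1

def W (w : Path) (n : ℕ) : ℤ := ∑ i ∈ Finset.range n, st (w i)

def L (w : Path) (z : ℤ) (n : ℕ) : ℕ := ((Finset.Icc 1 n).filter (fun k => W w k = z)).card

def A (w : Path) (m n : ℕ) : Finset ℤ :=
  ((Finset.Icc 1 n).image (W w)).filter (fun z => m ≤ L w z n)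

def C (w : Path) (m k : ℕ) : Prop := ∃ n, k ≤ (A w m n).card ∧ A w (m+1) n = ∅

def Hit (w : Path) (m k n : ℕ) : Prop :=
  k ≤ (A w m n).card ∧ (∀ n' < n, (A w m n').card < k) ∧ A w (m+1) n = ∅

def shift (n : ℕ) (w : Path) : Path := fun i => w (n + i)

lemma W_zero (w : Path) : W w 0 = 0 := by simp [W]

lemma W_succ (w : Path) (n : ℕ) : W w (n+1) = W w n + st (w n) := by
  simp [W, Finset.sum_range_succ]

lemma W_add (w : Path) (n i : ℕ) : W w (n+i) = W w n + W (shift n w) i := by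
  simp [W, Finset.sum_range_add, shift]

lemma st_abs (b : Bool) : |st b| = 1 := by cases b <;> simp [st]

lemma W_abs (w : Path) (n : ℕ) : |W w n| ≤ n := by
  induction n with
  | zero => simp [W_zero]
  | succ n ih =>
    rw [W_succ]
    calc _ ≤ |W w n| + |st (w n)| := abs_add_le _ _
      _ ≤ _ := by rw [st_abs]; push_cast; linarith

lemma W_congr {w v : Path} {n k : ℕ} (h : ∀ i < n, w i = v i) (hk : k ≤ n) : W w k = W v k := by
  unfold W
  apply Finset.sum_congr rfl
  intro i hi
  rw [h i (by simp at hi; omega)]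

lemma L_congr {w v : Path} {n k : ℕ} (h : ∀ i < n, w i = v i) (hk : k ≤ n) (z : ℤ) :
    L w z k = L v z k := by
  unfold L
  congr 1
  apply Finset.filter_congr
  intro i hi
  rw [W_congr h (by simp at hi; omega)]

lemma L_zero (w : Path) (z : ℤ) : L w z 0 = 0 := by simp [L]

lemma L_succ (w : Path) (z : ℤ) (n : ℕ) :
    L w z (n+1) = L w z n + if W w (n+1) = z then 1 else 0 := by
  unfold L
  rw [← Finset.insert_Icc_right_eq_Icc_add_one (by omega), Finset.filter_insert]
  split_ifs with h
  · rw [Finset.card_insert_of_notMem (by simp)]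
  · simp

lemma L_mono (w : Path) (z : ℤ) : Monotone (L w z) :=
  monotone_nat_of_le_succ fun n => by rw [L_succ]; omega

lemma L_add_le (w : Path) (z : ℤ) (n i : ℕ) : L w z (n+i) ≤ L w z n + i := by
  induction i with
  | zero => simp
  | succ i ih => rw [← add_assoc, L_succ]; split_ifs <;> omega

lemma L_lt_of_visit {w : Path} {z : ℤ} {n k : ℕ} (h : W w k = z) (hn : n < k) :
    L w z n + 1 ≤ L w z k := by
  obtain ⟨k, rfl⟩ : ∃ j, k = j + 1 := ⟨k-1, by omega⟩
  rw [L_succ, if_pos h]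
  have := L_mono w z (show n ≤ k by omega)
  omega

lemma mem_A {w : Path} {m n : ℕ} {z : ℤ} (hm : 1 ≤ m) : z ∈ A w m n ↔ m ≤ L w z n := by
  unfold A
  simp only [Finset.mem_filter, Finset.mem_image, and_iff_right_iff_imp]
  intro h
  have : 0 < L w z n := by omega
  unfold L at this
  rw [Finset.card_pos] at this
  obtain ⟨k, hk⟩ := this
  rw [Finset.mem_filter] at hk
  exact ⟨k, hk⟩

lemma A_congr {w v : Path} {n k : ℕ} (h : ∀ i < n, w i = v i) (hk : k ≤ n) {m : ℕ} (hm : 1 ≤ m) :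
    A w m k = A v m k := by
  ext z
  rw [mem_A hm, mem_A hm, L_congr h hk]

lemma A_mono (w : Path) {m : ℕ} (hm : 1 ≤ m) : Monotone (A w m) := by
  intro a b hab z hz
  rw [mem_A hm] at *
  exact hz.trans (L_mono w z hab)

lemma A_anti (w : Path) {m m' : ℕ} (hm : 1 ≤ m) (h : m ≤ m') (n : ℕ) : A w m' n ⊆ A w m n := by
  intro z hz
  rw [mem_A (by omega)] at *
  omega

lemma A_zero (w : Path) (m : ℕ) : A w m 0 = ∅ := by simp [A]

lemma A_succ (w : Path) {m : ℕ} (hm : 1 ≤ m) (n : ℕ) :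
    A w m (n+1) ⊆ insert (W w (n+1)) (A w m n) := by
  intro z hz
  rw [mem_A hm, L_succ] at hz
  rw [Finset.mem_insert, mem_A hm]
  split_ifs at hz with h
  · exact Or.inl h.symm
  · exact Or.inr (by omega)

lemma A_succ_card (w : Path) {m : ℕ} (hm : 1 ≤ m) (n : ℕ) :
    (A w m (n+1)).card ≤ (A w m n).card + 1 :=
  (Finset.card_le_card (A_succ w hm n)).trans (Finset.card_insert_le _ _)

lemma A_empty {w : Path} {m n : ℕ} (hm : 1 ≤ m) (h : A w m n = ∅) (z : ℤ) : L w z n < m := by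
  by_contra hc
  have : z ∈ A w m n := (mem_A hm).2 (by omega)
  simp [h] at this

lemma C_iff {w : Path} {m k : ℕ} (hm : 1 ≤ m) : C w m k ↔ ∃ n, Hit w m k n := by
  classical
  constructor
  · rintro ⟨n, h1, h2⟩
    have hex : ∃ n, k ≤ (A w m n).card := ⟨n, h1⟩
    refine ⟨Nat.find hex, Nat.find_spec hex, fun n' hn' => ?_, ?_⟩
    · have := Nat.find_min hex hn'; omega
    · have := A_mono w (show 1 ≤ m+1 by omega) (Nat.find_min' hex h1)
      rw [h2] at this
      exact Finset.subset_empty.1 this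
  · rintro ⟨n, h1, _, h2⟩
    exact ⟨n, h1, h2⟩

lemma Hit_unique {w : Path} {m k n n' : ℕ} (h : Hit w m k n) (h' : Hit w m k n') : n = n' := by
  rcases lt_trichotomy n n' with hl | hl | hl
  · have := h'.2.1 n hl; have := h.1; omega
  · exact hl
  · have := h.2.1 n' hl; have := h'.1; omega

lemma Hit_props {w : Path} {m k n : ℕ} (hm : 1 ≤ m) (hk : 1 ≤ k) (h : Hit w m k n) :
    1 ≤ n ∧ (A w m n).card = k ∧ L w (W w n) n = m := by
  obtain ⟨h1, h2, h3⟩ := h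
  have hn : 1 ≤ n := by
    by_contra hc
    obtain rfl : n = 0 := by omega
    rw [A_zero] at h1; simp at h1; omega
  obtain ⟨j, rfl⟩ : ∃ j, n = j + 1 := ⟨n-1, by omega⟩
  have h4 := A_succ_card w hm j
  have h5 := h2 j (by omega)
  refine ⟨hn, by omega, ?_⟩
  have h6 : W w (j+1) ∈ A w m (j+1) := by
    by_contra hc
    have : A w m (j+1) ⊆ A w m j := by
      intro z hz
      have := A_succ w hm j hz
      rw [Finset.mem_insert] at this
      rcases this with rfl | h
      · exact absurd hz hc
      · exact h
    have := Finset.card_le_card this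
    omega
  rw [mem_A hm] at h6
  have := A_empty (by omega) h3 (W w (j+1))
  omega

lemma Hit_lt {w : Path} {m k n n' : ℕ} (hm : 1 ≤ m) (hk : 1 ≤ k) (h : Hit w m k n)
    (h' : Hit w m (k+1) n') : n < n' := by
  by_contra hc
  have := Finset.card_le_card (A_mono w hm (show n' ≤ n by omega))
  have := h'.1
  have := (Hit_props hm hk h).2.1
  omega

lemma exists_Hit_of_succ {w : Path} {m k n' : ℕ} (hm : 1 ≤ m)
    (h' : Hit w m (k+1) n') : ∃ n, Hit w m k n :=
  (C_iff hm).1 ⟨n', by have := h'.1; omega, h'.2.2⟩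

def Gd (w : Path) (m H n : ℕ) : Prop :=
  ∀ a b : ℤ, a < b → b ≤ a + H → ¬ (m ≤ L w a n + H ∧ m ≤ L w b n + H)

lemma Gd_anti {w : Path} {m H n n' : ℕ} (h : n ≤ n') (hg : Gd w m H n') : Gd w m H n := by
  intro a b hab hb ⟨h1, h2⟩
  have := L_mono w a h
  have := L_mono w b h
  exact hg a b hab hb ⟨by omega, by omega⟩

def Ret (w : Path) (H : ℕ) : Prop := ∃ i, 1 ≤ i ∧ i ≤ H ∧ W w i = 0

lemma step_upper {w : Path} {m k H n n' : ℕ} (hm : 1 ≤ m) (hk : 1 ≤ k)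
    (h : Hit w m k n) (h' : Hit w m (k+1) n') (hg : Gd w m H n) : ¬ Ret (shift n w) H := by
  rintro ⟨i, hi1, hi2, hi⟩
  have hlt := Hit_lt hm hk h h'
  obtain ⟨-, -, hL⟩ := Hit_props hm hk h
  obtain ⟨-, -, hL'⟩ := Hit_props hm (by omega) h'
  have hret : W w (n+i) = W w n := by rw [W_add, hi, add_zero]
  have hLi := L_lt_of_visit hret (show n < n+i by omega)
  have hn' : n' < n + i := by
    by_contra hc
    have := L_mono w (W w n) (show n + i ≤ n' by omega)
    have := A_empty (by omega) h'.2.2 (W w n)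
    omega
  have hne : W w n' ≠ W w n := by
    intro he
    have := L_lt_of_visit he hlt
    have := A_empty (by omega) h'.2.2 (W w n)
    omega
  obtain ⟨j, rfl⟩ : ∃ j, n' = n + j := ⟨n'-n, by omega⟩
  have h1 := L_add_le w (W w (n+j)) n j
  have h2 := W_abs (shift n w) j
  have h3 := W_add w n j
  rw [abs_le] at h2
  rcases lt_or_gt_of_ne hne with hl | hl
  · exact hg _ _ hl (by omega) ⟨by omega, by omega⟩
  · exact hg _ _ hl (by omega) ⟨by omega, by omega⟩

def Gd' (w : Path) (m n : ℕ) : Prop := ∀ z ∈ A w m n, z ≤ W w n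

def Pos (w : Path) : Prop := ∀ i, 1 ≤ i → 0 < W w i

lemma step_lower {w : Path} {m k n : ℕ} (hm : 1 ≤ m) (hk : 1 ≤ k)
    (h : Hit w m k n) (hg : Gd' w m n) (hp : Pos (shift n w)) (hN : ∃ N, A w (m+1) N ≠ ∅) :
    C w m (k+1) := by
  classical
  have hs := Nat.find_spec hN
  have hmin : ∀ j < Nat.find hN, A w (m+1) j = ∅ := fun j hj => by
    have := Nat.find_min hN hj; simpa using this
  generalize Nat.find hN = N at hs hmin
  have hnN : n < N := by
    by_contra hc
    have := A_mono w (show 1 ≤ m+1 by omega) (show N ≤ n by omega)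
    rw [h.2.2] at this
    exact hs (Finset.subset_empty.1 this)
  obtain ⟨j, rfl⟩ : ∃ j, N = j + 1 := ⟨N-1, by omega⟩
  have hj := hmin j (by omega)
  refine ⟨j, ?_, hj⟩
  obtain ⟨z, hz⟩ := Finset.nonempty_iff_ne_empty.2 hs
  have hz' := A_succ w (by omega) j hz
  rw [hj] at hz'
  simp only [insert_empty_eq, Finset.mem_singleton] at hz'
  have hzL : z ∈ A w m j := by
    rw [mem_A (by omega), L_succ] at hz
    rw [mem_A hm]
    split_ifs at hz <;> omega
  have hzn : z ∉ A w m n := by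
    intro hc
    have := hg z hc
    obtain ⟨i, hi⟩ : ∃ i, j + 1 = n + i := ⟨j+1-n, by omega⟩
    rw [hz', hi, W_add] at this
    have := hp i (by omega)
    omega
  have hsub : insert z (A w m n) ⊆ A w m j := by
    intro y hy
    rcases Finset.mem_insert.1 hy with rfl | hy
    · exact hzL
    · exact A_mono w hm (by omega) hy
  have := Finset.card_le_card hsub
  rw [Finset.card_insert_of_notMem hzn, (Hit_props hm hk h).2.1] at this
  exact this

def BadD (w : Path) (m H R : ℕ) : Prop :=
  ∃ a ∈ Finset.Icc (-(R:ℤ)) R, ∃ d ∈ Finset.Icc 1 H,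
    2 * m ≤ L w a R + L w (a + (d:ℕ)) R + 2 * H

def BadE (w : Path) (m H R : ℕ) : Prop :=
  ∃ b ∈ Finset.Icc (-(R:ℤ)) R, ∃ n, (W w n = b ∧ L w b n = m ∧ 1 ≤ n) ∧
    ∃ i, 1 ≤ i ∧ W (shift n w) i ≤ -(H:ℤ)

def Bad (w : Path) (m H R : ℕ) : Prop := A w (m+1) R = ∅ ∨ BadD w m H R ∨ BadE w m H R

lemma L_pos_visit {w : Path} {z : ℤ} {n j : ℕ} (hj : 1 ≤ j) (h : j ≤ L w z n) :
    ∃ k, 1 ≤ k ∧ k ≤ n ∧ W w k = z ∧ L w z k = j := by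
  induction n with
  | zero => rw [L_zero] at h; omega
  | succ n ih =>
    by_cases h' : j ≤ L w z n
    · obtain ⟨k, h1, h2, h3⟩ := ih h'
      exact ⟨k, h1, by omega, h3⟩
    · have := L_succ w z n
      split_ifs at this with hc
      · exact ⟨n+1, by omega, le_rfl, hc, by omega⟩
      · omega

lemma visit_range {w : Path} {z : ℤ} {n R : ℕ} (hn : n ≤ R) (h : 1 ≤ L w z n) :
    z ∈ Finset.Icc (-(R:ℤ)) R := by
  obtain ⟨k, h1, h2, h3, -⟩ := L_pos_visit le_rfl h
  have := W_abs w k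
  rw [abs_le] at this
  rw [Finset.mem_Icc]
  omega

lemma le_of_empty {w : Path} {m n R : ℕ} (hn : A w (m+1) n = ∅) (hR : A w (m+1) R ≠ ∅) : n ≤ R := by
  by_contra hc
  have := A_mono w (show 1 ≤ m+1 by omega) (show R ≤ n by omega)
  rw [hn] at this
  exact hR (Finset.subset_empty.1 this)

lemma upper_cases {w : Path} {m k H n R : ℕ} (hH : H < m)
    (h : Hit w m k n) : Gd w m H n ∨ Bad w m H R := by
  by_contra hc
  push Not at hc
  obtain ⟨hc1, hc2⟩ := hc
  simp only [Bad, not_or] at hc2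
  obtain ⟨hF, hD, -⟩ := hc2
  have hn := le_of_empty h.2.2 hF
  apply hc1
  intro a b hab hb ⟨h1, h2⟩
  apply hD
  have ha' := L_mono w a hn
  have hb' := L_mono w b hn
  refine ⟨a, visit_range (w := w) hn (by omega), (b-a).toNat, Finset.mem_Icc.2 ⟨by omega, by omega⟩, ?_⟩
  have : a + ((b-a).toNat : ℤ) = b := by omega
  rw [this]; omega

lemma lower_cases {w : Path} {m k H n R : ℕ} (hm : 1 ≤ m) (hk : 1 ≤ k)
    (h : Hit w m k n) : Gd' w m n ∨ Bad w m H R := by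
  by_contra hc
  push Not at hc
  obtain ⟨hc1, hc2⟩ := hc
  simp only [Bad, not_or] at hc2
  obtain ⟨hF, hD, hE⟩ := hc2
  have hn := le_of_empty h.2.2 hF
  apply hc1
  intro b hb
  by_contra hlt
  push Not at hlt
  rw [mem_A hm] at hb
  obtain ⟨hn1, -, hL⟩ := Hit_props hm hk h
  by_cases hd : b ≤ W w n + H
  · apply hD
    have ha' := L_mono w (W w n) hn
    have hb' := L_mono w b hn
    refine ⟨W w n, visit_range (w := w) hn (by omega), (b-W w n).toNat,
      Finset.mem_Icc.2 ⟨by omega, by omega⟩, ?_⟩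
    have : W w n + ((b-W w n).toNat : ℤ) = b := by omega
    rw [this]; omega
  · apply hE
    obtain ⟨j, h1, h2, h3, h4⟩ := L_pos_visit hm hb
    have hjn : j ≠ n := by rintro rfl; omega
    refine ⟨b, visit_range (w := w) hn (by omega), j, ⟨h3, h4, h1⟩, n - j, by omega, ?_⟩
    have := W_add w j (n-j)
    rw [show j + (n-j) = n by omega] at this
    omega

end GW

namespace GW

noncomputable def mu (ν : Measure Bool) : Measure Path := Measure.infinitePi (fun _ : ℕ => ν)

instance (ν : Measure Bool) [IsProbabilityMeasure ν] : IsProbabilityMeasure (mu ν) := by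
  unfold mu; infer_instance

def Dep (n : ℕ) (E : Set Path) : Prop := ∀ w v : Path, (∀ i < n, w i = v i) → w ∈ E → v ∈ E

lemma Dep.meas {n : ℕ} {E : Set Path} (h : Dep n E) : MeasurableSet E := by
  have : E = (fun (w : Path) (i : Fin n) => w i) ⁻¹' ((fun (w : Path) (i : Fin n) => w i) '' E) := by
    ext v
    constructor
    · intro hv; exact ⟨v, hv, rfl⟩
    · rintro ⟨w, hw, hwv⟩
      exact h w v (fun i hi => congrFun hwv ⟨i, hi⟩) hw
  rw [this]
  have hm : Measurable (fun (w : Path) (i : Fin n) => w i) := by fun_prop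
  exact hm (Set.toFinite _).measurableSet

lemma shift_meas (n : ℕ) : Measurable (shift n) := by
  unfold shift; fun_prop

def glue (n : ℕ) (x : Path × Path) : Path := fun i => if i < n then x.1 i else x.2 (i - n)

lemma glue_meas (n : ℕ) : Measurable (glue n) := by
  unfold glue
  rw [measurable_pi_iff]
  intro i
  split_ifs <;> fun_prop

lemma map_glue (ν : Measure Bool) [IsProbabilityMeasure ν] (n : ℕ) :
    ((mu ν).prod (mu ν)).map (glue n) = mu ν := by
  classical
  apply Measure.eq_infinitePi
  intro s t ht
  rw [Measure.map_apply (glue_meas n) (MeasurableSet.pi s.countable_toSet (fun i _ => ht i))]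
  have : glue n ⁻¹' ((s : Set ℕ).pi t) =
      (((s.filter (· < n) : Finset ℕ) : Set ℕ).pi t) ×ˢ
      ((((s.filter (¬ · < n)).image (· - n) : Finset ℕ) : Set ℕ).pi (fun i => t (i + n))) := by
    ext ⟨u, v⟩
    simp only [mem_preimage, Set.mem_pi, mem_prod, Finset.mem_coe, Finset.mem_filter, Finset.mem_image,
      glue]
    constructor
    · intro h
      refine ⟨fun i hi => by simpa [hi.2] using h i hi.1, ?_⟩
      rintro _ ⟨i, hi, rfl⟩
      have := h i hi.1
      rw [if_neg hi.2] at this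
      rwa [show i - n + n = i by omega]
    · rintro ⟨h1, h2⟩ i hi
      split_ifs with h
      · exact h1 i ⟨hi, h⟩
      · have := h2 (i-n) ⟨i, ⟨hi, h⟩, rfl⟩
        rwa [show i - n + n = i by omega] at this
  rw [this, Measure.prod_prod]
  unfold mu
  rw [Measure.infinitePi_pi _ (fun i _ => ht i), Measure.infinitePi_pi _ (fun i _ => ht _),
    Finset.prod_image, ← Finset.prod_filter_mul_prod_filter_not s (· < n)]
  · congr 1
    apply Finset.prod_congr rfl
    intro i hi
    simp only [Finset.mem_filter] at hi
    rw [show i - n + n = i by omega]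
  · intro a ha b hb hab
    simp at ha hb hab
    omega

lemma markov (ν : Measure Bool) [IsProbabilityMeasure ν] {n : ℕ} {E B : Set Path}
    (hE : Dep n E) (hB : MeasurableSet B) :
    mu ν (E ∩ shift n ⁻¹' B) = mu ν E * mu ν B := by
  have h := map_glue ν n
  conv_lhs => rw [← h]
  rw [Measure.map_apply (glue_meas n) (hE.meas.inter (shift_meas n hB)), ← Measure.prod_prod]
  congr 1
  ext ⟨u, v⟩
  have h1 : glue n (u, v) ∈ E ↔ u ∈ E :=
    ⟨hE _ _ (fun i hi => by simp [glue, hi]), hE _ _ (fun i hi => by simp [glue, hi])⟩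
  have h2 : shift n (glue n (u, v)) = v := by
    funext i; simp [glue, shift]
  simp only [mem_preimage, mem_inter_iff, mem_prod, h1, h2]

lemma smarkov (ν : Measure Bool) [IsProbabilityMeasure ν] {E : ℕ → Set Path} {B : Set Path}
    (hE : ∀ n, Dep n (E n)) (hd : ∀ w n n', w ∈ E n → w ∈ E n' → n = n') (hB : MeasurableSet B) :
    (mu ν).real (⋃ n, E n ∩ shift n ⁻¹' B) = (mu ν).real (⋃ n, E n) * (mu ν).real B := by
  have hdis : Pairwise (Function.onFun Disjoint E) := by
    intro a b hab
    rw [Function.onFun, Set.disjoint_left]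
    intro w h1 h2
    exact hab (hd w a b h1 h2)
  have hdis' : Pairwise (Function.onFun Disjoint (fun n => E n ∩ shift n ⁻¹' B)) := by
    intro a b hab
    exact (hdis hab).mono inter_subset_left inter_subset_left
  simp only [Measure.real]
  rw [← ENNReal.toReal_mul, measure_iUnion hdis (fun n => (hE n).meas),
    measure_iUnion hdis' (fun n => (hE n).meas.inter (shift_meas n hB)), ← ENNReal.tsum_mul_right]
  simp only [markov ν (hE _) hB]

lemma first_step (ν : Measure Bool) [IsProbabilityMeasure ν] {p q : ℝ} (hp : ν.real {true} = p)
    (hq : ν.real {false} = q) {E : Set Path} {B : Bool → Set Path}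
    (hB : ∀ b, MeasurableSet (B b))
    (h : ∀ w, w ∈ E ↔ shift 1 w ∈ B (w 0)) :
    (mu ν).real E = p * (mu ν).real (B true) + q * (mu ν).real (B false) := by
  have hc : ∀ b, (mu ν).real {w | w 0 = b} = ν.real {b} := by
    intro b
    simp only [Measure.real]
    congr 1
    have := (measurePreserving_eval_infinitePi (fun _ : ℕ => ν) 0).measure_preimage
      (s := {b}) (by simp)
    exact this
  have hD : ∀ b, Dep 1 {w : Path | w 0 = b} := by
    intro b w v hwv hw
    simp only [mem_ofPred_eq] at *
    rw [← hwv 0 (by omega), hw]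
  have hm : ∀ b, (mu ν).real ({w : Path | w 0 = b} ∩ shift 1 ⁻¹' (B b)) =
      ν.real {b} * (mu ν).real (B b) := by
    intro b
    rw [← hc b]
    simp only [Measure.real]
    rw [markov ν (hD b) (hB b), ENNReal.toReal_mul]
  have : E = ({w : Path | w 0 = true} ∩ shift 1 ⁻¹' (B true)) ∪
      ({w : Path | w 0 = false} ∩ shift 1 ⁻¹' (B false)) := by
    ext w
    rw [h w]
    simp only [mem_union, mem_inter_iff, mem_ofPred_eq, mem_preimage]
    cases w 0 <;> simp
  rw [this, measureReal_union, hm, hm, hp, hq]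
  · rw [Set.disjoint_left]
    rintro w ⟨h1, -⟩ ⟨h2, -⟩
    simp only [mem_ofPred_eq] at h1 h2
    rw [h1] at h2; cases h2
  · exact (hD false).meas.inter (shift_meas 1 (hB _))

end GW

namespace GW

open scoped Classical in
noncomputable def cnt (s : Set ℤ) (n : ℕ) (w : Path) (x : ℤ) : ℕ :=
  ∑ i ∈ Finset.range n, if x + W w (i+1) ∈ s then 1 else 0

open scoped Classical in
lemma cnt_succ (s : Set ℤ) (n : ℕ) (w : Path) (x : ℤ) :
    cnt s (n+1) w x = cnt s n (shift 1 w) (x + st (w 0)) + if x + st (w 0) ∈ s then 1 else 0 := by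
  unfold cnt
  rw [Finset.sum_range_succ']
  have h0 : W w 1 = st (w 0) := by simp [W]
  congr 1
  · apply Finset.sum_congr rfl
    intro i _
    rw [show i + 1 + 1 = 1 + (i+1) by ring, W_add, h0, add_assoc]
  · rw [zero_add, h0]

lemma cnt_dep (s : Set ℤ) (n : ℕ) (x : ℤ) (P : ℕ → Prop) : Dep n {w | P (cnt s n w x)} := by
  intro w v h hw
  have : cnt s n v x = cnt s n w x := by
    unfold cnt
    apply Finset.sum_congr rfl
    intro i hi
    rw [W_congr h (by simp at hi; omega)]
  simpa [this] using hw

lemma L_eq_cnt (w : Path) (z : ℤ) (n : ℕ) : L w z n = cnt {z} n w 0 := by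
  induction n with
  | zero => simp [L_zero, cnt]
  | succ n ih =>
    rw [L_succ, ih]
    unfold cnt
    rw [Finset.sum_range_succ]
    congr 1
    simp

lemma L_pair_eq_cnt (w : Path) {a b : ℤ} (hab : a ≠ b) (n : ℕ) :
    L w a n + L w b n = cnt {a, b} n w 0 := by
  induction n with
  | zero => simp [L_zero, cnt]
  | succ n ih =>
    have : cnt {a, b} (n+1) w 0 = cnt {a, b} n w 0 +
      (if W w (n+1) = a ∨ W w (n+1) = b then 1 else 0) := by
      unfold cnt
      rw [Finset.sum_range_succ]
      congr 1
      simp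
    rw [L_succ, L_succ, this, ← ih]
    by_cases h1 : W w (n+1) = a
    · have : W w (n+1) ≠ b := by rw [h1]; exact hab
      simp [h1, hab]; omega
    · by_cases h2 : W w (n+1) = b
      · simp [h2, hab.symm]; omega
      · simp [h1, h2]

section
variable (ν : Measure Bool) [IsProbabilityMeasure ν] {p q : ℝ}

open scoped Classical in
lemma lyap (hp : ν.real {true} = p) (hq : ν.real {false} = q)
    (s : Set ℤ) (φ : ℤ → ℝ) (l c : ℝ) (hl : 0 < l) (hc : 0 ≤ c) (hφ : ∀ x, 0 ≤ φ x)
    (hs : ∀ x ∈ s, 1 ≤ c * φ x)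
    (hsup : ∀ x, p * φ (x+1) + q * φ (x-1) ≤ (if x ∈ s then l else 1) * φ x) (n : ℕ) :
    ∀ (j : ℕ) (x : ℤ), (mu ν).real {w | j + 1 ≤ cnt s n w x} ≤
      c * l^j * ((if x ∈ s then l else 1) * φ x) := by
  have hp0 : 0 ≤ p := by rw [← hp]; positivity
  have hq0 : 0 ≤ q := by rw [← hq]; positivity
  induction n with
  | zero =>
    intro j x
    have : {w : Path | j + 1 ≤ cnt s 0 w x} = ∅ := by ext w; simp [cnt]
    rw [this, measureReal_empty]
    have := hφ x
    split_ifs <;> positivity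
  | succ n ih =>
    intro j x
    rw [first_step ν hp hq (E := {w | j + 1 ≤ cnt s (n+1) w x})
      (B := fun b => {w | j + 1 ≤ cnt s n w (x + st b) + if x + st b ∈ s then 1 else 0})
      (fun b => (cnt_dep s n (x + st b) (fun k => j + 1 ≤ k + if x + st b ∈ s then 1 else 0)).meas)
      (fun w => by simp only [mem_ofPred_eq]; rw [cnt_succ])]
    have key : ∀ y, (mu ν).real {w | j + 1 ≤ cnt s n w y + if y ∈ s then 1 else 0} ≤
        c * l^j * φ y := by
      intro y
      by_cases hy : y ∈ s
      · simp only [hy, if_true]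
        rcases Nat.eq_zero_or_pos j with rfl | hj
        · calc _ ≤ (1:ℝ) := measureReal_le_one
            _ ≤ _ := by simpa using hs y hy
        · have := ih (j-1) y
          simp only [hy, if_true] at this
          obtain ⟨i, rfl⟩ : ∃ i, j = i + 1 := ⟨j-1, by omega⟩
          simp only [Nat.add_sub_cancel] at this
          calc _ = (mu ν).real {w | i + 1 ≤ cnt s n w y} := by
                congr 1; ext w; simp
            _ ≤ _ := this
            _ = _ := by ring
      · have := ih j y
        simp only [hy, if_false, one_mul] at this
        simpa [hy] using this
    have h1 := key (x+1)
    have h2 := key (x-1)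
    have e1 : x + st true = x + 1 := by simp [st]
    have e2 : x + st false = x - 1 := by simp [st]; ring
    rw [e1, e2]
    calc _ ≤ p * (c * l^j * φ (x+1)) + q * (c * l^j * φ (x-1)) := by gcongr
      _ = c * l^j * (p * φ (x+1) + q * φ (x-1)) := by ring
      _ ≤ _ := by
        have := hsup x
        gcongr

lemma real_iUnion_le {E : ℕ → Set Path} (hE : Monotone E) {c : ℝ}
    (h : ∀ n, (mu ν).real (E n) ≤ c) : (mu ν).real (⋃ n, E n) ≤ c := by
  have := tendsto_measure_iUnion_atTop (μ := mu ν) hE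
  have h2 := (ENNReal.tendsto_toReal (measure_ne_top (mu ν) (⋃ n, E n))).comp this
  exact le_of_tendsto' h2 h

end

lemma harm {p q : ℝ} (hp : 0 < p) (hq : 0 < q) (hpq : p + q = 1) (x : ℤ) :
    p * (q/p)^(x+1) + q * (q/p)^(x-1) = (q/p)^x := by
  have h : q/p ≠ 0 := by positivity
  rw [zpow_add₀ h, zpow_sub₀ h, zpow_one]
  field_simp
  rw [add_comm, hpq]

end GW

namespace GW

section
variable (ν : Measure Bool) [IsProbabilityMeasure ν] {p q : ℝ}

lemma phi1_sup (hq0 : 0 < q) (hqp : q < p) (hpq : p + q = 1) (x : ℤ) :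
    p * min 1 ((q/p)^(x+1)) + q * min 1 ((q/p)^(x-1)) ≤ min 1 ((q/p)^x) := by
  have hp0 : 0 < p := hq0.trans hqp
  apply le_min
  · calc _ ≤ p * 1 + q * 1 := by gcongr <;> exact min_le_left _ _
      _ = 1 := by linarith
  · rw [← harm hp0 hq0 hpq x]
    gcongr <;> exact min_le_right _ _

lemma cnt_pos_iff (s : Set ℤ) (n : ℕ) (w : Path) (x : ℤ) :
    0 + 1 ≤ cnt s n w x ↔ ∃ i, 1 ≤ i ∧ i ≤ n ∧ x + W w i ∈ s := by
  unfold cnt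
  rw [zero_add, Nat.one_le_iff_ne_zero, ne_eq, Finset.sum_eq_zero_iff]
  constructor
  · intro h
    push Not at h
    obtain ⟨i, hi, h⟩ := h
    refine ⟨i+1, by omega, by simp at hi; omega, ?_⟩
    by_contra hc; simp [hc] at h
  · rintro ⟨i, h1, h2, h3⟩ h
    have := h (i-1) (by simp; omega)
    rw [show i - 1 + 1 = i by omega] at this
    simp [h3] at this

lemma hit_le (hp : ν.real {true} = p) (hq : ν.real {false} = q) (hq0 : 0 < q) (hqp : q < p)
    (hpq : p + q = 1) (H : ℕ) :
    (mu ν).real {w | ∃ i, 1 ≤ i ∧ W w i ≤ -(H:ℤ)} ≤ (q/p)^H := by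
  have hp0 : 0 < p := hq0.trans hqp
  have hr1 : q/p ≤ 1 := by rw [div_le_one hp0]; exact hqp.le
  have : {w : Path | ∃ i, 1 ≤ i ∧ W w i ≤ -(H:ℤ)} =
      ⋃ n, {w | 0 + 1 ≤ cnt (Set.Iic (-(H:ℤ))) n w 0} := by
    ext w
    simp only [mem_iUnion, mem_ofPred_eq, cnt_pos_iff, mem_Iic, zero_add]
    constructor
    · rintro ⟨i, h1, h2⟩; exact ⟨i, i, h1, le_rfl, h2⟩
    · rintro ⟨_, i, h1, _, h2⟩; exact ⟨i, h1, h2⟩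
  rw [this]
  apply real_iUnion_le
  · intro a b hab w
    simp only [mem_ofPred_eq, cnt_pos_iff]
    rintro ⟨i, h1, h2, h3⟩
    exact ⟨i, h1, by omega, h3⟩
  · intro n
    have := lyap ν hp hq (Set.Iic (-(H:ℤ))) (fun x => min 1 ((q/p)^(x+H))) 1 1 one_pos zero_le_one
      (fun x => by positivity) ?_ ?_ n 0 0
    · refine this.trans ?_
      simp
    · intro x hx
      simp only [one_mul]
      apply le_min le_rfl
      apply one_le_zpow_of_nonpos₀ (by positivity) hr1
      simp at hx; omega
    · intro x
      simp only [ite_self, one_mul]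
      have := phi1_sup hq0 hqp hpq (x + H)
      rwa [show x + H + 1 = x + 1 + H by ring, show x + H - 1 = x - 1 + H by ring] at this

lemma Pos_meas : MeasurableSet {w : Path | Pos w} := by
  have : {w : Path | Pos w} = ⋂ i, {w | 1 ≤ i → 0 < W w i} := by
    ext w; simp [Pos]
  rw [this]
  refine MeasurableSet.iInter fun i => Dep.meas (n := i) ?_
  intro w v h hw
  simp only [mem_ofPred_eq] at *
  rwa [← W_congr h le_rfl]

lemma Neg_meas (H : ℤ) : MeasurableSet {w : Path | ∃ i, 1 ≤ i ∧ W w i ≤ H} := by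
  have : {w : Path | ∃ i, 1 ≤ i ∧ W w i ≤ H} = ⋃ i, {w | 1 ≤ i ∧ W w i ≤ H} := by
    ext w; simp
  rw [this]
  refine MeasurableSet.iUnion fun i => Dep.meas (n := i) ?_
  intro w v h hw
  simp only [mem_ofPred_eq] at *
  rwa [← W_congr h le_rfl]

lemma Pos_ge (hp : ν.real {true} = p) (hq : ν.real {false} = q) (hq0 : 0 < q) (hqp : q < p)
    (hpq : p + q = 1) : 1 - 2*q ≤ (mu ν).real {w | Pos w} := by
  have hp0 : 0 < p := hq0.trans hqp
  rw [first_step ν hp hq (E := {w | Pos w})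
    (B := fun b => if b then {w : Path | ∃ i, 1 ≤ i ∧ W w i ≤ -((1:ℕ):ℤ)}ᶜ else ∅)]
  · simp only [if_true]
    rw [probReal_compl_eq_one_sub (Neg_meas _)]
    have := hit_le ν hp hq hq0 hqp hpq 1
    have h2 : p * (q/p)^1 = q := by field_simp
    have h3 : p * (mu ν).real {w | ∃ i, 1 ≤ i ∧ W w i ≤ -((1:ℕ):ℤ)} ≤ q := by
      rw [← h2]; gcongr
    simp only [Bool.false_eq_true, if_false, measureReal_empty]
    linarith
  · intro b
    cases b
    · simp
    · simpa using (Neg_meas (-1))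
  · intro w
    have h1 : W w 1 = st (w 0) := by simp [W]
    simp only [mem_ofPred_eq, Pos]
    cases hw : w 0
    · simp only [Bool.false_eq_true, if_false, mem_empty_iff_false, iff_false]
      intro h
      have := h 1 le_rfl
      rw [h1, hw] at this
      simp [st] at this
    · simp only [if_true, mem_compl_iff, mem_ofPred_eq, not_exists, not_and, not_le]
      have hs : ∀ i, W w (1+i) = 1 + W (shift 1 w) i := by
        intro i; rw [W_add, h1, hw]; simp [st]
      constructor
      · intro h i hi
        have := h (1+i) (by omega)
        rw [hs] at this
        push_cast; omega
      · intro h i hi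
        obtain ⟨j, rfl⟩ : ∃ j, i = 1 + j := ⟨i-1, by omega⟩
        rw [hs]
        rcases Nat.eq_zero_or_pos j with rfl | hj
        · simp [W_zero]
        · have := h j hj
          push_cast at this; omega

lemma visit_le (hp : ν.real {true} = p) (hq : ν.real {false} = q) (hq0 : 0 < q) (hqp : q < p)
    (hpq : p + q = 1) (z : ℤ) (m : ℕ) :
    (mu ν).real {w | ∃ n, m + 1 ≤ L w z n} ≤ (2*q)^m := by
  have hp0 : 0 < p := hq0.trans hqp
  have : {w : Path | ∃ n, m + 1 ≤ L w z n} = ⋃ n, {w | m + 1 ≤ cnt {z} n w 0} := by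
    ext w; simp [L_eq_cnt]
  rw [this]
  apply real_iUnion_le
  · intro a b hab w
    simp only [mem_ofPred_eq, ← L_eq_cnt]
    intro h
    exact h.trans (L_mono w z hab)
  · intro n
    have := lyap ν hp hq {z} (fun x => min 1 ((q/p)^(x-z))) (2*q) 1 (by positivity) zero_le_one
      (fun x => by positivity) ?_ ?_ n m 0
    · refine this.trans ?_
      rw [one_mul]
      apply mul_le_of_le_one_right (by positivity)
      refine mul_le_one₀ ?_ (by positivity) (min_le_left _ _)
      split_ifs <;> linarith
    · intro x hx
      simp only [mem_singleton_iff] at hx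
      simp [hx]
    · intro x
      by_cases hx : x = z
      · subst hx
        simp only [mem_singleton_iff, if_true, sub_self, zpow_zero, min_self, mul_one]
        calc _ ≤ p * (q/p)^(x+1-x) + q * 1 := by
              gcongr
              · exact min_le_right _ _
              · exact min_le_left _ _
          _ = 2 * q := by rw [add_sub_cancel_left, zpow_one]; field_simp; ring
      · simp only [mem_singleton_iff, hx, if_false, one_mul]
        have := phi1_sup hq0 hqp hpq (x - z)
        rwa [show x - z + 1 = x + 1 - z by ring, show x - z - 1 = x - 1 - z by ring] at this

lemma pair_le (hp : ν.real {true} = p) (hq : ν.real {false} = q) (hq0 : 0 < q) (hqp : q < p)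
    (hpq : p + q = 1) {t l : ℝ} (ht0 : 0 < t) (ht : t^2 = q/p) (hl : l = (2*q+t)/(1+t))
    (a : ℤ) {d : ℕ} (hd : 1 ≤ d) (n j : ℕ) :
    (mu ν).real {w | j + 1 ≤ L w a n + L w (a+d) n} ≤ (t^d)⁻¹ * l^j := by
  have hp0 : 0 < p := hq0.trans hqp
  have ht1 : t < 1 := by
    have : t^2 < 1 := by rw [ht, div_lt_one hp0]; exact hqp
    nlinarith
  obtain ⟨u, hu⟩ : ∃ u, u = t^d := ⟨_, rfl⟩
  have hu0 : 0 < u := by rw [hu]; positivity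
  have hut : u ≤ t := by rw [hu]; exact pow_le_of_le_one ht0.le ht1.le (by omega)
  have hu2 : (q/p)^(d:ℤ) = u^2 := by rw [zpow_natCast, ← ht, hu]; ring
  have hl0 : 0 < l := by rw [hl]; positivity
  have hl1 : l ≤ 1 := by rw [hl, div_le_one (by positivity)]; linarith
  have hlu : (2*q+u)/(1+u) ≤ l := by
    rw [hl, div_le_div_iff₀ (by positivity) (by positivity)]
    nlinarith
  have hr0 : 0 < q/p := by positivity
  have hab : a ≠ a + d := by omega
  have : {w : Path | j + 1 ≤ L w a n + L w (a+d) n} = {w | j + 1 ≤ cnt {a, a+(d:ℤ)} n w 0} := by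
    ext w; simp only [mem_ofPred_eq]; rw [L_pair_eq_cnt w hab]
  rw [this, ← hu]
  have hr : ∀ y : ℤ, (q/p)^(a + d - a + y) = u^2 * (q/p)^y := by
    intro y; rw [zpow_add₀ hr0.ne', show a + (d:ℤ) - a = d by ring, hu2]
  set φ : ℤ → ℝ := fun x => min 1 (min ((u + (q/p)^(x-a))/(1+u)) ((q/p)^(x-a)/u)) with hφ
  have hφ1 : ∀ x, φ x ≤ 1 := fun x => min_le_left _ _
  have hφ2 : ∀ x, φ x ≤ (u + (q/p)^(x-a))/(1+u) := fun x => (min_le_right _ _).trans (min_le_left _ _)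
  have hφ3 : ∀ x, φ x ≤ (q/p)^(x-a)/u := fun x => (min_le_right _ _).trans (min_le_right _ _)
  have hφ0 : ∀ x, 0 ≤ φ x := fun x => by simp only [hφ]; positivity
  have hφa : φ a = 1 := by
    simp only [hφ, sub_self, zpow_zero]
    rw [add_comm u 1, div_self (by positivity), ← min_assoc, min_self, min_eq_left]
    rw [le_div_iff₀ hu0]; linarith
  have hφb : φ (a+d) = u := by
    simp only [hφ]
    have := hr 0
    rw [add_zero] at this
    rw [this, zpow_zero, mul_one]
    have e1 : (u + u^2)/(1+u) = u := by field_simp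
    have e2 : u^2/u = u := by field_simp
    rw [e1, e2, min_self, min_eq_right]
    linarith
  have hh := fun x : ℤ => harm hp0 hq0 hpq (x - a)
  have := lyap ν hp hq {a, a+(d:ℤ)} φ l u⁻¹ hl0 (by positivity) hφ0 ?_ ?_ n j 0
  · refine this.trans ?_
    apply mul_le_of_le_one_right (by positivity)
    refine mul_le_one₀ ?_ (hφ0 _) (hφ1 _)
    split_ifs <;> linarith
  · intro x hx
    rcases hx with rfl | hx
    · rw [hφa, mul_one]; exact (one_le_inv₀ hu0).2 (by linarith)
    · rw [mem_singleton_iff] at hx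
      rw [hx, hφb, inv_mul_cancel₀ hu0.ne']
  · intro x
    have s1 : x + 1 - a = x - a + 1 := by ring
    have s2 : x - 1 - a = x - a - 1 := by ring
    by_cases hxa : x = a
    · subst hxa
      simp only [mem_insert_iff, true_or, if_true, hφa, mul_one]
      calc _ ≤ p * ((u + (q/p)^(x+1-x))/(1+u)) + q * 1 := by
            gcongr
            · exact hφ2 _
            · exact hφ1 _
        _ = (2*q+u)/(1+u) := by
            rw [add_sub_cancel_left, zpow_one]
            field_simp
            linear_combination u * hpq
        _ ≤ l := hlu
    by_cases hxb : x = a + d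
    · subst hxb
      simp only [mem_insert_iff, mem_singleton_iff, or_true, if_true, hφb]
      calc _ ≤ p * ((q/p)^(a+d+1-a)/u) + q * ((u + (q/p)^(a+d-1-a))/(1+u)) := by
            gcongr
            · exact hφ3 _
            · exact hφ2 _
        _ = (2*q+u)/(1+u) * u := by
            rw [s1, s2, hr 1, show a + (d:ℤ) - a - 1 = a + d - a + (-1) by ring, hr (-1), zpow_one,
              zpow_neg_one]
            field_simp
            linear_combination u * hpq
        _ ≤ l * u := by gcongr
    · have : x ∉ ({a, a+(d:ℤ)} : Set ℤ) := by simp [hxa, hxb]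
      simp only [this, if_false, one_mul]
      apply le_min
      · calc _ ≤ p * 1 + q * 1 := by gcongr <;> exact hφ1 _
          _ = 1 := by linarith
      apply le_min
      · calc _ ≤ p * ((u + (q/p)^(x+1-a))/(1+u)) + q * ((u + (q/p)^(x-1-a))/(1+u)) := by
              gcongr <;> exact hφ2 _
          _ = _ := by
              rw [← hh x, s1, s2]
              field_simp
              linear_combination u * hpq
      · calc _ ≤ p * ((q/p)^(x+1-a)/u) + q * ((q/p)^(x-1-a)/u) := by
              gcongr <;> exact hφ3 _
          _ = _ := by
              rw [← hh x, s1, s2]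
              ring

end
end GW

namespace GW

lemma L_add (w : Path) (z : ℤ) (n i : ℕ) :
    L w z (n+i) = L w z n + L (shift n w) (z - W w n) i := by
  induction i with
  | zero => simp [L_zero]
  | succ i ih =>
    rw [← add_assoc, L_succ, ih, L_succ, add_assoc n i 1, W_add, add_assoc]
    congr 2
    have : W w n + W (shift n w) (i+1) = z ↔ W (shift n w) (i+1) = z - W w n := by
      constructor <;> intro h <;> linarith
    simp only [this]

section
variable (ν : Measure Bool) [IsProbabilityMeasure ν] {p q : ℝ}

lemma hitz_dep (n : ℕ) (x : ℤ) : Dep n {w : Path | ∃ i, i ≤ n ∧ x + W w i = 0} := by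
  rintro w v h ⟨i, h1, h2⟩
  exact ⟨i, h1, by rw [← W_congr h h1]; exact h2⟩

lemma hitz_ge (hp : ν.real {true} = p) (hq : ν.real {false} = q) (hq0 : 0 < q) (hqp : q < p)
    (hpq : p + q = 1) {t : ℝ} (ht0 : 0 < t) (ht : t^2 = q/p) (n : ℕ) : ∀ x : ℤ,
    min 1 ((q/p)^x) - (2*p*t)^n * t^x ≤ (mu ν).real {w | ∃ i, i ≤ n ∧ x + W w i = 0} := by
  have hp0 : 0 < p := hq0.trans hqp
  have hr0 : 0 < q/p := by positivity
  have hr1 : q/p ≤ 1 := by rw [div_le_one hp0]; exact hqp.le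
  have ht1 : t ≤ 1 := by
    have : t^2 ≤ 1 := by rw [ht]; exact hr1
    nlinarith
  have hqt : q = p * t^2 := by rw [ht]; field_simp
  induction n with
  | zero =>
    intro x
    have : min 1 ((q/p)^x) ≤ t^x := by
      rcases le_total 0 x with hx | hx
      · apply (min_le_right _ _).trans
        rw [← ht, ← zpow_natCast, ← zpow_mul]
        apply zpow_le_zpow_right_of_le_one₀ ht0 ht1
        push_cast; omega
      · apply (min_le_left _ _).trans
        exact one_le_zpow_of_nonpos₀ ht0 ht1 hx
    have h0 : 0 ≤ (mu ν).real {w : Path | ∃ i, i ≤ 0 ∧ x + W w i = 0} := measureReal_nonneg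
    simp only [pow_zero, one_mul]
    linarith
  | succ n ih =>
    intro x
    by_cases hx : x = 0
    · subst hx
      have : {w : Path | ∃ i, i ≤ n+1 ∧ 0 + W w i = 0} = univ := by
        ext w; simp only [mem_ofPred_eq, mem_univ, iff_true]
        exact ⟨0, by omega, by simp [W_zero]⟩
      rw [this, probReal_univ]
      simp only [zpow_zero, min_self, mul_one]
      have : 0 ≤ (2*p*t)^(n+1) := by positivity
      linarith
    · rw [first_step ν hp hq (E := {w | ∃ i, i ≤ n+1 ∧ x + W w i = 0})
        (B := fun b => {w | ∃ i, i ≤ n ∧ x + st b + W w i = 0})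
        (fun b => (hitz_dep n _).meas)]
      · have e1 : x + st true = x + 1 := by simp [st]
        have e2 : x + st false = x - 1 := by simp [st]; ring
        rw [e1, e2]
        have h1 := ih (x+1)
        have h2 := ih (x-1)
        have hmin : min 1 ((q/p)^x) ≤ p * min 1 ((q/p)^(x+1)) + q * min 1 ((q/p)^(x-1)) := by
          rcases lt_or_gt_of_ne hx with hl | hl
          · rw [min_eq_left (one_le_zpow_of_nonpos₀ hr0 hr1 (by omega : x + 1 ≤ 0)),
              min_eq_left (one_le_zpow_of_nonpos₀ hr0 hr1 (by omega : x - 1 ≤ 0))]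
            apply (min_le_left _ _).trans; linarith
          · rw [min_eq_right (zpow_le_one₀ hr0 hr1 (by omega : 0 ≤ x + 1)),
              min_eq_right (zpow_le_one₀ hr0 hr1 (by omega : 0 ≤ x - 1)), harm hp0 hq0 hpq]
            exact min_le_right _ _
        have ht' : p * t^(x+1) + q * t^(x-1) = 2*p*t*t^x := by
          rw [zpow_add₀ ht0.ne', zpow_sub₀ ht0.ne', zpow_one, hqt]
          field_simp; ring
        calc _ ≤ p * (min 1 ((q/p)^(x+1)) - (2*p*t)^n * t^(x+1)) +
              q * (min 1 ((q/p)^(x-1)) - (2*p*t)^n * t^(x-1)) := by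
              have : (2*p*t)^(n+1) * t^x = (2*p*t)^n * (p * t^(x+1) + q * t^(x-1)) := by
                rw [ht']; ring
              rw [this]; linarith
          _ ≤ _ := by gcongr
      · intro w
        simp only [mem_ofPred_eq]
        have hs : ∀ i, W w (1+i) = st (w 0) + W (shift 1 w) i := by
          intro i; rw [W_add]; simp [W]
        constructor
        · rintro ⟨i, h1, h2⟩
          rcases Nat.eq_zero_or_pos i with rfl | hi
          · rw [W_zero] at h2; omega
          · refine ⟨i-1, by omega, ?_⟩
            have := hs (i-1)
            rw [show 1 + (i-1) = i by omega] at this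
            omega
        · rintro ⟨i, h1, h2⟩
          refine ⟨1+i, by omega, ?_⟩
          have := hs i
          omega

lemma Ret_dep (H : ℕ) : Dep H {w : Path | Ret w H} := by
  rintro w v h ⟨i, h1, h2, h3⟩
  exact ⟨i, h1, h2, by rw [← W_congr h h2]; exact h3⟩

lemma Ret_ge (hp : ν.real {true} = p) (hq : ν.real {false} = q) (hq0 : 0 < q) (hqp : q < p)
    (hpq : p + q = 1) {t : ℝ} (ht0 : 0 < t) (ht : t^2 = q/p) (n : ℕ) :
    2*q - (2*p*t)^(n+1) ≤ (mu ν).real {w | Ret w (n+1)} := by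
  have hp0 : 0 < p := hq0.trans hqp
  have hr0 : 0 < q/p := by positivity
  have hr1 : q/p ≤ 1 := by rw [div_le_one hp0]; exact hqp.le
  have hqt : q = p * t^2 := by rw [ht]; field_simp
  rw [first_step ν hp hq (E := {w | Ret w (n+1)})
        (B := fun b => {w | ∃ i, i ≤ n ∧ st b + W w i = 0})
        (fun b => (hitz_dep n _).meas)]
  · have h1 := hitz_ge ν hp hq hq0 hqp hpq ht0 ht n (st true)
    have h2 := hitz_ge ν hp hq hq0 hqp hpq ht0 ht n (st false)
    have e1 : st true = 1 := by simp [st]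
    have e2 : st false = -1 := by simp [st]
    rw [e1] at h1 ⊢
    rw [e2] at h2 ⊢
    rw [zpow_one, zpow_one, min_eq_right hr1] at h1
    rw [min_eq_left (one_le_zpow_of_nonpos₀ hr0 hr1 (by omega)), zpow_neg_one] at h2
    calc _ = p * (q/p - (2*p*t)^n * t) + q * (1 - (2*p*t)^n * t⁻¹) := by
          have a1 : p * (q/p) = q := by field_simp
          have a2 : q * t⁻¹ = p * t := by rw [hqt]; field_simp
          linear_combination -a1 + (2*p*t)^n * a2
      _ ≤ _ := by gcongr
  · intro w
    have hs : ∀ i, W w (1+i) = st (w 0) + W (shift 1 w) i := by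
      intro i; rw [W_add]; simp [W]
    simp only [mem_ofPred_eq, Ret]
    constructor
    · rintro ⟨i, h0, h1, h2⟩
      refine ⟨i-1, by omega, ?_⟩
      have := hs (i-1)
      rw [show 1 + (i-1) = i by omega] at this
      omega
    · rintro ⟨i, h1, h2⟩
      refine ⟨1+i, by omega, by omega, ?_⟩
      have := hs i
      omega

lemma manyvis_dep (j n : ℕ) : Dep n {w : Path | j ≤ L w 0 n} := by
  intro w v h hw
  simp only [mem_ofPred_eq] at *
  rwa [← L_congr h le_rfl]

lemma manyvis (h j : ℕ) :
    ((mu ν).real {w | Ret w h})^j ≤ (mu ν).real {w | j ≤ L w 0 (j*h)} := by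
  classical
  induction j with
  | zero => simp
  | succ j ih =>
    set E : ℕ → Set Path := fun n => {w | (1 ≤ n ∧ n ≤ h ∧ W w n = 0) ∧ ∀ i, 1 ≤ i → i < n → W w i ≠ 0}
      with hE
    have h1 := smarkov ν (E := E) (B := {w | j ≤ L w 0 (j*h)}) ?_ ?_ (manyvis_dep _ _).meas
    · have h2 : {w | Ret w h} = ⋃ n, E n := by
        ext w
        simp only [hE, mem_iUnion, mem_ofPred_eq]
        constructor
        · intro hr
          have hs := Nat.find_spec hr
          refine ⟨Nat.find hr, hs, fun i hi hlt h0 => ?_⟩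
          exact Nat.find_min hr hlt ⟨hi, by omega, h0⟩
        · rintro ⟨n, hn, -⟩; exact ⟨n, hn⟩
      rw [← h2] at h1
      calc _ = (mu ν).real {w | Ret w h} * (mu ν).real {w | Ret w h} ^ j := by ring
        _ ≤ (mu ν).real {w | Ret w h} * (mu ν).real {w | j ≤ L w 0 (j*h)} := by gcongr
        _ = _ := h1.symm
        _ ≤ _ := by
          apply measureReal_mono _ (measure_ne_top _ _)
          intro w hw
          simp only [mem_iUnion, hE, mem_inter_iff, mem_ofPred_eq, mem_preimage] at hw
          obtain ⟨n, ⟨⟨a1, a2, a3⟩, -⟩, a4⟩ := hw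
          simp only [mem_ofPred_eq]
          have b1 := L_add w 0 n (j*h)
          rw [a3, sub_zero] at b1
          have b2 := L_mono w 0 (show n + j*h ≤ (j+1)*h by rw [add_mul]; omega)
          have b3 := L_lt_of_visit a3 (show 0 < n by omega)
          omega
    · rintro n w v hwv ⟨⟨a1, a2, a3⟩, a4⟩
      refine ⟨⟨a1, a2, by rw [← W_congr hwv le_rfl]; exact a3⟩, fun i h1 h2 => ?_⟩
      rw [← W_congr hwv h2.le]; exact a4 i h1 h2
    · rintro w n n' ⟨⟨a1, a2, a3⟩, a4⟩ ⟨⟨b1, b2, b3⟩, b4⟩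
      rcases lt_trichotomy n n' with hl | hl | hl
      · exact absurd a3 (b4 n a1 hl)
      · exact hl
      · exact absurd b3 (a4 n' b1 hl)

lemma empty_dep (m n : ℕ) : Dep n {w : Path | A w (m+1) n = ∅} := by
  intro w v h hw
  simp only [mem_ofPred_eq] at *
  rwa [← A_congr h le_rfl (by omega)]

lemma badF_le (h m N : ℕ) :
    (mu ν).real {w | A w (m+1) (N*((m+1)*h)) = ∅} ≤
      (1 - ((mu ν).real {w | Ret w h})^(m+1))^N := by
  have hnn : 0 ≤ 1 - ((mu ν).real {w | Ret w h})^(m+1) := by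
    have := pow_le_one₀ (n := m+1) (measureReal_nonneg (μ := mu ν) (s := {w | Ret w h})) measureReal_le_one
    linarith
  induction N with
  | zero => simp
  | succ N ih =>
    have hm := manyvis ν h (m+1)
    set T := (m+1)*h
    have hmk := markov ν (empty_dep m (N*T)) (manyvis_dep (m+1) T).meas.compl
    calc _ ≤ (mu ν).real ({w | A w (m+1) (N*T) = ∅} ∩ shift (N*T) ⁻¹' {w | m+1 ≤ L w 0 T}ᶜ) := by
          apply measureReal_mono _ (measure_ne_top _ _)
          intro w hw
          simp only [mem_ofPred_eq] at hw
          refine ⟨?_, ?_⟩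
          · have := A_mono w (show 1 ≤ m+1 by omega) (show N*T ≤ (N+1)*T by rw [add_mul]; omega)
            rw [hw] at this
            exact Finset.subset_empty.1 this
          · simp only [mem_preimage, mem_compl_iff, mem_ofPred_eq]
            have h1 := A_empty (by omega) hw (W w (N*T))
            rw [show (N+1)*T = N*T + T by ring, L_add, sub_self] at h1
            omega
      _ = (mu ν).real {w | A w (m+1) (N*T) = ∅} * (mu ν).real ({w | m+1 ≤ L w 0 T}ᶜ) := by
          simp only [Measure.real]; rw [hmk, ENNReal.toReal_mul]
      _ ≤ (1 - ((mu ν).real {w | Ret w h})^(m+1))^N * (1 - ((mu ν).real {w | Ret w h})^(m+1)) := by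
          rw [probReal_compl_eq_one_sub (manyvis_dep (m+1) T).meas]
          have : (mu ν).real {w | m+1 ≤ L w 0 T} ≤ 1 := measureReal_le_one
          have h0 : 0 ≤ 1 - (mu ν).real {w | m+1 ≤ L w 0 T} := by linarith
          gcongr
      _ = _ := by ring

end
end GW

namespace GW

section
variable (ν : Measure Bool) [IsProbabilityMeasure ν] {p q : ℝ}

lemma card_Icc_R (R : ℕ) : ((Finset.Icc (-(R:ℤ)) R).card : ℝ) = 2*R+1 := by
  rw [Int.card_Icc]
  have : ((R:ℤ) + 1 - -(R:ℤ)).toNat = 2*R+1 := by omega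
  rw [this]; push_cast; ring

lemma badD_le (hp : ν.real {true} = p) (hq : ν.real {false} = q) (hq0 : 0 < q) (hqp : q < p)
    (hpq : p + q = 1) {t l : ℝ} (ht0 : 0 < t) (ht : t^2 = q/p) (hl : l = (2*q+t)/(1+t))
    {m H : ℕ} (hH : H < m) (R : ℕ) :
    (mu ν).real {w | BadD w m H R} ≤ (2*R+1) * (H * ((t^H)⁻¹ * l^(2*m-2*H-1))) := by
  have hp0 : 0 < p := hq0.trans hqp
  have ht1 : t ≤ 1 := by
    have : t^2 < 1 := by rw [ht, div_lt_one hp0]; exact hqp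
    nlinarith
  have hl0 : 0 < l := by rw [hl]; positivity
  have : {w : Path | BadD w m H R} = ⋃ a ∈ Finset.Icc (-(R:ℤ)) R, ⋃ d ∈ Finset.Icc 1 H,
      {w | 2 * m ≤ L w a R + L w (a + (d:ℕ)) R + 2 * H} := by
    ext w; simp only [BadD, mem_iUnion, mem_ofPred_eq, exists_prop]
  rw [this]
  calc _ ≤ ∑ a ∈ Finset.Icc (-(R:ℤ)) R, (mu ν).real (⋃ d ∈ Finset.Icc 1 H,
      {w | 2 * m ≤ L w a R + L w (a + (d:ℕ)) R + 2 * H}) := measureReal_biUnion_finset_le _ _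
    _ ≤ ∑ a ∈ Finset.Icc (-(R:ℤ)) R, (H * ((t^H)⁻¹ * l^(2*m-2*H-1))) := by
      apply Finset.sum_le_sum
      intro a _
      calc _ ≤ ∑ d ∈ Finset.Icc 1 H, (mu ν).real
            {w | 2 * m ≤ L w a R + L w (a + (d:ℕ)) R + 2 * H} := measureReal_biUnion_finset_le _ _
        _ ≤ ∑ d ∈ Finset.Icc 1 H, ((t^H)⁻¹ * l^(2*m-2*H-1)) := by
          apply Finset.sum_le_sum
          intro d hd
          rw [Finset.mem_Icc] at hd
          have h1 := pair_le ν hp hq hq0 hqp hpq ht0 ht hl a hd.1 R (2*m-2*H-1)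
          have e : {w : Path | 2 * m ≤ L w a R + L w (a + (d:ℕ)) R + 2 * H} =
            {w | 2*m-2*H-1+1 ≤ L w a R + L w (a + (d:ℕ)) R} := by
            ext w; simp only [mem_ofPred_eq]; omega
          rw [e]
          refine h1.trans ?_
          have : t^H ≤ t^d := pow_le_pow_of_le_one ht0.le ht1 hd.2
          gcongr
        _ = _ := by simp
    _ = _ := by rw [Finset.sum_const, nsmul_eq_mul, card_Icc_R]

lemma badE_le (hp : ν.real {true} = p) (hq : ν.real {false} = q) (hq0 : 0 < q) (hqp : q < p)
    (hpq : p + q = 1) {m : ℕ} (hm : 1 ≤ m) (H R : ℕ) :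
    (mu ν).real {w | BadE w m H R} ≤ (2*R+1) * ((2*q)^(m-1) * (q/p)^H) := by
  have hp0 : 0 < p := hq0.trans hqp
  have : {w : Path | BadE w m H R} = ⋃ b ∈ Finset.Icc (-(R:ℤ)) R,
      ⋃ n, {w | W w n = b ∧ L w b n = m ∧ 1 ≤ n} ∩ shift n ⁻¹' {w | ∃ i, 1 ≤ i ∧ W w i ≤ -(H:ℤ)} := by
    ext w; simp only [BadE, mem_iUnion, mem_ofPred_eq, exists_prop, mem_inter_iff, mem_preimage]
  rw [this]
  refine (measureReal_biUnion_finset_le _ _).trans ?_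
  rw [← card_Icc_R, ← nsmul_eq_mul, ← Finset.sum_const]
  apply Finset.sum_le_sum
  intro b _
  rw [smarkov ν _ _ (Neg_meas _)]
  · gcongr
    · refine le_trans ?_ (visit_le ν hp hq hq0 hqp hpq b (m-1))
      apply measureReal_mono _ (measure_ne_top _ _)
      intro w hw
      simp only [mem_iUnion, mem_ofPred_eq] at hw ⊢
      obtain ⟨n, -, h, -⟩ := hw
      exact ⟨n, by omega⟩
    · exact hit_le ν hp hq hq0 hqp hpq H
  · rintro n w v h ⟨h1, h2, h3⟩
    exact ⟨by rw [← W_congr h le_rfl]; exact h1, by rw [← L_congr h le_rfl]; exact h2, h3⟩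
  · rintro w n n' ⟨h1, h2, h3⟩ ⟨h1', h2', h3'⟩
    rcases lt_trichotomy n n' with hl | hl | hl
    · have := L_lt_of_visit h1' hl; omega
    · exact hl
    · have := L_lt_of_visit h1 hl; omega

lemma bad_le (hp : ν.real {true} = p) (hq : ν.real {false} = q) (hq0 : 0 < q) (hqp : q < p)
    (hpq : p + q = 1) {t l : ℝ} (ht0 : 0 < t) (ht : t^2 = q/p) (hl : l = (2*q+t)/(1+t))
    {m H : ℕ} (hH : H < m) (h N : ℕ) :
    (mu ν).real {w | Bad w m H (N*((m+1)*h))} ≤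
      (1 - ((mu ν).real {w | Ret w h})^(m+1))^N +
      (2*((N*((m+1)*h) : ℕ) : ℝ)+1) * (H * ((t^H)⁻¹ * l^(2*m-2*H-1)) + (2*q)^(m-1) * (q/p)^H) := by
  set R := N*((m+1)*h)
  have : {w | Bad w m H R} = {w | A w (m+1) R = ∅} ∪ ({w | BadD w m H R} ∪ {w | BadE w m H R}) := by
    ext w; simp [Bad]
  rw [this]
  refine (measureReal_union_le _ _).trans ?_
  refine add_le_add (badF_le ν h m N) ?_
  refine (measureReal_union_le _ _).trans ?_
  rw [mul_add]
  exact add_le_add (badD_le ν hp hq hq0 hqp hpq ht0 ht hl hH R)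
    (badE_le ν hp hq hq0 hqp hpq (by omega) H R)

lemma Hit_congr {w v : Path} {m k n : ℕ} (hm : 1 ≤ m) (h : ∀ i < n, w i = v i) (hw : Hit w m k n) :
    Hit v m k n := by
  obtain ⟨h1, h2, h3⟩ := hw
  refine ⟨by rwa [← A_congr h le_rfl hm], fun n' hn' => ?_, by rwa [← A_congr h le_rfl (by omega)]⟩
  rw [← A_congr h hn'.le hm]; exact h2 n' hn'

lemma upper_main {m : ℕ} (hm : 1 ≤ m) (H k : ℕ) :
    (mu ν).real (⋃ n, {w | Hit w m (k+1) n ∧ Gd w m H n}) ≤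
      (1 - (mu ν).real {w | Ret w H})^k := by
  induction k with
  | zero => simp
  | succ k ih =>
    have h1 := smarkov ν (E := fun n => {w | Hit w m (k+1) n ∧ Gd w m H n})
      (B := {w | Ret w H}ᶜ) ?_ ?_ (Ret_dep H).meas.compl
    · rw [probReal_compl_eq_one_sub (Ret_dep H).meas] at h1
      have h0 : 0 ≤ 1 - (mu ν).real {w | Ret w H} := by
        have : (mu ν).real {w | Ret w H} ≤ 1 := measureReal_le_one
        linarith
      calc _ ≤ (mu ν).real (⋃ n, {w | Hit w m (k+1) n ∧ Gd w m H n} ∩ shift n ⁻¹' {w | Ret w H}ᶜ) := by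
            apply measureReal_mono _ (measure_ne_top _ _)
            intro w hw
            simp only [mem_iUnion, mem_ofPred_eq] at hw
            obtain ⟨n', h2, h3⟩ := hw
            obtain ⟨n, hn⟩ := exists_Hit_of_succ hm h2
            have hlt := Hit_lt hm (by omega) hn h2
            have hg := Gd_anti hlt.le h3
            simp only [mem_iUnion]
            exact ⟨n, ⟨hn, hg⟩, step_upper hm (by omega) hn h2 hg⟩
        _ = _ := h1
        _ ≤ (1 - (mu ν).real {w | Ret w H})^k * (1 - (mu ν).real {w | Ret w H}) := by gcongr
        _ = _ := by ring
    · rintro n w v h ⟨h1, h2⟩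
      refine ⟨Hit_congr hm h h1, ?_⟩
      intro a b hab hb
      rw [← L_congr h le_rfl, ← L_congr h le_rfl]
      exact h2 a b hab hb
    · rintro w n n' ⟨h1, -⟩ ⟨h2, -⟩
      exact Hit_unique h1 h2

lemma upper_C {m H : ℕ} (hH : H < m) (R k : ℕ) :
    (mu ν).real {w | C w m (k+1)} ≤
      (1 - (mu ν).real {w | Ret w H})^k + (mu ν).real {w | Bad w m H R} := by
  have hm : 1 ≤ m := by omega
  refine le_trans ?_ (add_le_add (upper_main ν hm H k) le_rfl)
  refine le_trans ?_ (measureReal_union_le _ _)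
  apply measureReal_mono _ (measure_ne_top _ _)
  intro w hw
  obtain ⟨n, hn⟩ := (C_iff hm).1 hw
  rcases upper_cases (R := R) hH hn with h | h
  · exact Or.inl (mem_iUnion.2 ⟨n, hn, h⟩)
  · exact Or.inr h

/-- `J` is determined by the path up to the first time a site gets `m` visits. -/
def Jdep (m : ℕ) (J : Set Path) : Prop :=
  ∀ n (w v : Path), (∀ i < n, w i = v i) → A w m n ≠ ∅ → w ∈ J → v ∈ J

lemma C_one {w : Path} {m : ℕ} (hm : 1 ≤ m) (hN : ∃ N, A w (m+1) N ≠ ∅) : C w m 1 := by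
  classical
  have hs := Nat.find_spec hN
  have hmin : ∀ j < Nat.find hN, A w (m+1) j = ∅ := fun j hj => by
    have := Nat.find_min hN hj; simpa using this
  generalize Nat.find hN = N at hs hmin
  have hN0 : N ≠ 0 := by rintro rfl; exact hs (A_zero _ _)
  obtain ⟨j, rfl⟩ : ∃ j, N = j + 1 := ⟨N-1, by omega⟩
  refine ⟨j, ?_, hmin j (by omega)⟩
  obtain ⟨z, hz⟩ := Finset.nonempty_iff_ne_empty.2 hs
  rw [mem_A (by omega), L_succ] at hz
  have : z ∈ A w m j := by
    rw [mem_A hm]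
    split_ifs at hz <;> omega
  exact Finset.card_pos.2 ⟨z, this⟩

lemma real_mono_ae {s t : Set Path} (h : ∀ᵐ w ∂(mu ν), w ∈ s → w ∈ t) :
    (mu ν).real s ≤ (mu ν).real t :=
  ENNReal.toReal_mono (measure_ne_top _ _) (measure_mono_ae h)

lemma lower_main {m : ℕ} (hm : 1 ≤ m) (H R k : ℕ) {J : Set Path} (hJ : Jdep m J)
    (hfin : ∀ᵐ w ∂(mu ν), ∃ N, A w (m+1) N ≠ ∅) :
    ((mu ν).real {w | Pos w})^k * (mu ν).real J - k * (mu ν).real {w | Bad w m H R} ≤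
      (mu ν).real (⋃ n, {w | w ∈ J ∧ Hit w m (k+1) n ∧ Gd' w m n}) := by
  induction k with
  | zero =>
    simp only [pow_zero, one_mul, CharP.cast_eq_zero, zero_mul, sub_zero, zero_add]
    apply real_mono_ae ν
    filter_upwards [hfin] with w hw hwJ
    obtain ⟨n, hn⟩ := (C_iff hm).1 (C_one hm hw)
    refine mem_iUnion.2 ⟨n, hwJ, hn, ?_⟩
    obtain ⟨-, h1, h2⟩ := Hit_props hm le_rfl hn
    intro z hz
    have h3 : W w n ∈ A w m n := (mem_A hm).2 h2.ge
    exact (Finset.card_le_one.1 h1.le z hz _ h3).le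
  | succ k ih =>
    have h1 := smarkov ν (E := fun n => {w | w ∈ J ∧ Hit w m (k+1) n ∧ Gd' w m n})
      (B := {w | Pos w}) ?_ ?_ Pos_meas
    · have h2 : (mu ν).real (⋃ n, {w | w ∈ J ∧ Hit w m (k+1) n ∧ Gd' w m n} ∩ shift n ⁻¹' {w | Pos w})
          ≤ (mu ν).real ((⋃ n, {w | w ∈ J ∧ Hit w m (k+1+1) n ∧ Gd' w m n}) ∪ {w | Bad w m H R}) := by
        apply real_mono_ae ν
        filter_upwards [hfin] with w hw hw1
        obtain ⟨n, ⟨hwJ, hn, hg⟩, hp⟩ := mem_iUnion.1 hw1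
        obtain ⟨n', hn'⟩ := (C_iff hm).1 (step_lower hm (by omega) hn hg hp hw)
        rcases lower_cases (H := H) (R := R) hm (by omega) hn' with h | h
        · exact Or.inl (mem_iUnion.2 ⟨n', hwJ, hn', h⟩)
        · exact Or.inr h
      have h3 := h2.trans (measureReal_union_le _ _)
      rw [h1] at h3
      have hP0 : 0 ≤ (mu ν).real {w | Pos w} := measureReal_nonneg
      have hP1 : (mu ν).real {w | Pos w} ≤ 1 := measureReal_le_one
      have hB0 : 0 ≤ (mu ν).real {w | Bad w m H R} := measureReal_nonneg
      have h4 := mul_le_mul_of_nonneg_right ih hP0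
      have h5 : (k:ℝ) * (mu ν).real {w | Bad w m H R} * (mu ν).real {w | Pos w} ≤
          k * (mu ν).real {w | Bad w m H R} := mul_le_of_le_one_right (by positivity) hP1
      push_cast
      rw [pow_succ]
      nlinarith
    · rintro n w v h ⟨h0, h1, h2⟩
      refine ⟨hJ n w v h ?_ h0, Hit_congr hm h h1, ?_⟩
      · intro he
        have := h1.1
        rw [he] at this; simp at this
      · intro z hz
        rw [← A_congr h le_rfl hm] at hz
        rw [← W_congr h le_rfl]
        exact h2 z hz
    · rintro w n n' ⟨-, h1, -⟩ ⟨-, h2, -⟩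
      exact Hit_unique h1 h2

end
end GW

namespace GW

lemma summ_poly {r : ℝ} (h0 : 0 < r) (h1 : r < 1) (k : ℕ) :
    Summable (fun m : ℕ => ((m:ℝ)+1)^k * r^m) := by
  have h := summable_pow_mul_geometric_of_norm_lt_one (R := ℝ) k (r := r)
    (by rw [Real.norm_eq_abs, abs_of_pos h0]; exact h1)
  have h2 := ((summable_nat_add_iff 1).2 h).mul_left r⁻¹
  refine h2.congr fun m => ?_
  push_cast
  rw [pow_succ r]
  field_simp

lemma alg_aux (m e c1 c2 B l y2 y3 : ℝ) :
    (m+1) * (e + c1 * (m+1)^2 * B⁻¹ * (l * (m+1) * y2 + c2 * y3)) =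
      (m+1)^1 * e + c1 * l * ((m+1)^4 * (y2 / B)) + c1 * c2 * ((m+1)^3 * (y3 / B)) := by
  simp only [div_eq_mul_inv]
  generalize B⁻¹ = y
  ring

/-- choice of constants -/
lemma consts {q l K r : ℝ} (hl0 : 0 < l) (hl : l^2 < 2*q) (hr0 : 0 < r) (hr1 : r < 1) :
    ∃ (σ τ : ℝ) (ℓ : ℕ), 1 < σ ∧ σ * l^2 < 2*q ∧ 0 < τ ∧ τ < 1 ∧ 2 ≤ ℓ ∧ K ≤ σ^ℓ ∧ r = τ^ℓ := by
  have h1 : 1 < 2*q/l^2 := by rw [one_lt_div (by positivity)]; exact hl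
  obtain ⟨σ, h2, h3⟩ := exists_between h1
  obtain ⟨n, hn⟩ := pow_unbounded_of_one_lt K h2
  refine ⟨σ, r^(((n+2:ℕ):ℝ)⁻¹), n+2, h2, (lt_div_iff₀ (by positivity)).1 h3, by positivity,
    Real.rpow_lt_one hr0.le hr1 (by positivity), by omega, ?_, ?_⟩
  · exact hn.le.trans (pow_le_pow_right₀ h2.le (by omega))
  · rw [Real.rpow_inv_natCast_pow hr0.le (by omega)]

lemma F_term {β : ℝ} (h0 : 0 < β) (h1 : β ≤ 1) (m : ℕ) :
    (1 - β^(m+1))^(⌈(m:ℝ) * (β^(m+1))⁻¹⌉₊) ≤ (Real.exp (-1))^m := by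
  have hb : 0 < β^(m+1) := by positivity
  have hb1 : β^(m+1) ≤ 1 := pow_le_one₀ h0.le h1
  have h2 : 1 - β^(m+1) ≤ Real.exp (-β^(m+1)) := by
    have := Real.add_one_le_exp (-β^(m+1)); linarith
  refine (pow_le_pow_left₀ (by linarith) h2 _).trans ?_
  rw [← Real.exp_nat_mul, ← Real.exp_nat_mul, Real.exp_le_exp]
  have := Nat.le_ceil ((m:ℝ) * (β^(m+1))⁻¹)
  have h3 : (m:ℝ) * (β^(m+1))⁻¹ * β^(m+1) = m := by field_simp
  nlinarith

lemma R_term {β : ℝ} (h0 : 0 < β) (h1 : β ≤ 1) (m h : ℕ) :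
    2*((⌈(m:ℝ) * (β^(m+1))⁻¹⌉₊*((m+1)*h) : ℕ):ℝ)+1 ≤ (2*h+1) * β⁻¹ * (m+1)^2 * (β^m)⁻¹ := by
  have hb : 0 < β^(m+1) := by positivity
  have hb1 : 1 ≤ (β^(m+1))⁻¹ := (one_le_inv₀ hb).2 (pow_le_one₀ h0.le h1)
  have hc := (Nat.ceil_lt_add_one (show 0 ≤ (m:ℝ) * (β^(m+1))⁻¹ by positivity)).le
  have e : (2*h+1) * β⁻¹ * ((m:ℝ)+1)^2 * (β^m)⁻¹ = (2*h+1)*(m+1)^2*(β^(m+1))⁻¹ := by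
    rw [pow_succ β, mul_inv]; ring
  rw [e]
  push_cast
  generalize (⌈(m:ℝ) * (β^(m+1))⁻¹⌉₊ : ℝ) = N at *
  generalize (β^(m+1))⁻¹ = y at *
  have hN : N ≤ (m+1)*y := by nlinarith
  have h3 : N * ((m+1)*h) ≤ (m+1)*y*((m+1)*h) := mul_le_mul_of_nonneg_right hN (by positivity)
  have h4 : (1:ℝ) ≤ (m+1)^2*y := by
    have : (1:ℝ) ≤ (m+1)^2 := by
      apply one_le_pow₀; linarith [(Nat.cast_nonneg m : (0:ℝ) ≤ m)]
    nlinarith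
  nlinarith

lemma D_term {t l σ : ℝ} (ht0 : 0 < t) (hl0 : 0 < l) (hs : 1 < σ) {ℓ : ℕ} (hℓ : 2 ≤ ℓ)
    (hK : t⁻¹ * (l^2)⁻¹ ≤ σ^ℓ) {m : ℕ} (hm : 1 ≤ m) :
    ((m/ℓ:ℕ):ℝ)*((t^(m/ℓ))⁻¹*l^(2*m-2*(m/ℓ)-1)) ≤ l⁻¹ * (m+1) * (σ*l^2)^m := by
  have hH : m/ℓ ≤ m := Nat.div_le_self _ _
  have hH2 : 2*(m/ℓ)+1 ≤ 2*m := by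
    have := Nat.div_lt_self hm (show 1 < ℓ by omega); omega
  have hmul : ℓ*(m/ℓ) ≤ m := Nat.mul_div_le m ℓ
  generalize m/ℓ = H at *
  have e : (t^H)⁻¹*l^(2*m-2*H-1) = l⁻¹ * (t⁻¹ * (l^2)⁻¹)^H * (l^2)^m := by
    have : (l^2)^m = l^(2*m-2*H-1) * (l^2)^H * l := by
      rw [← pow_mul, ← pow_mul, ← pow_add, ← pow_succ]; congr 1; omega
    rw [this, mul_pow, inv_pow, inv_pow]
    field_simp
  rw [e, mul_pow σ]
  have h1 : (t⁻¹ * (l^2)⁻¹)^H ≤ σ^m := by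
    calc _ ≤ (σ^ℓ)^H := pow_le_pow_left₀ (by positivity) hK _
      _ = σ^(ℓ*H) := by rw [pow_mul]
      _ ≤ _ := pow_le_pow_right₀ hs.le hmul
  have h2 : (H:ℝ) ≤ m+1 := by have : (H:ℝ) ≤ m := by exact_mod_cast hH
                              linarith
  calc (H:ℝ) * (l⁻¹ * (t⁻¹ * (l^2)⁻¹)^H * (l^2)^m) ≤ (m+1) * (l⁻¹ * σ^m * (l^2)^m) := by gcongr
    _ = _ := by ac_rfl

lemma E_term {q r τ : ℝ} (hq0 : 0 < q) (ht0 : 0 < τ) (ht1 : τ < 1) {ℓ : ℕ} (hℓ : 1 ≤ ℓ)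
    (hr : r = τ^ℓ) {m : ℕ} (hm : 1 ≤ m) :
    (2*q)^(m-1)*r^(m/ℓ) ≤ (2*q)⁻¹ * (τ^ℓ)⁻¹ * (2*q*τ)^m := by
  have h1 : m ≤ ℓ*(m/ℓ) + ℓ := by
    have := Nat.div_add_mod m ℓ
    have := Nat.mod_lt m (show 0 < ℓ by omega)
    omega
  generalize m/ℓ = H at *
  have h2 : r^H ≤ (τ^ℓ)⁻¹ * τ^m := by
    rw [hr, ← pow_mul, inv_mul_eq_div, le_div_iff₀ (by positivity), ← pow_add]
    exact pow_le_pow_of_le_one ht0.le ht1.le h1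
  have h3 : (2*q)^(m-1) = (2*q)⁻¹ * (2*q)^m := by
    obtain ⟨j, rfl⟩ : ∃ j, m = j+1 := ⟨m-1, by omega⟩
    rw [Nat.add_sub_cancel, pow_succ]; field_simp
  rw [h3, mul_pow _ τ]
  calc (2*q)⁻¹ * (2*q)^m * r^H ≤ (2*q)⁻¹ * (2*q)^m * ((τ^ℓ)⁻¹ * τ^m) := by gcongr
    _ = _ := by ac_rfl

section
variable (ν : Measure Bool) [IsProbabilityMeasure ν] {p q : ℝ}

lemma params (hq0 : 0 < q) (hqp : q < p) (hpq : p + q = 1) :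
    ∃ t : ℝ, 0 < t ∧ t^2 = q/p ∧ 0 < 2*p*t ∧ 2*p*t < 1 ∧ ((2*q+t)/(1+t))^2 < 2*q := by
  have hp0 : 0 < p := hq0.trans hqp
  have ht : (√(q/p))^2 = q/p := Real.sq_sqrt (by positivity)
  have ht0 : 0 < √(q/p) := Real.sqrt_pos.2 (by positivity)
  generalize √(q/p) = t at *
  have h1 : t^2 * p = q := by rw [ht]; field_simp
  refine ⟨t, ht0, ht, by positivity, ?_, ?_⟩
  · nlinarith [sq_nonneg (2*p*t-1), sq_nonneg (p-q), mul_pos ht0 hp0]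
  · rw [div_pow, div_lt_iff₀ (by positivity)]
    have : t^2 < 2*q := by rw [ht, div_lt_iff₀ hp0]; nlinarith
    nlinarith

lemma bad_summable (hp : ν.real {true} = p) (hq : ν.real {false} = q) (hq0 : 0 < q) (hqp : q < p)
    (hpq : p + q = 1) :
    ∃ H R : ℕ → ℕ, Tendsto H atTop atTop ∧ (∀ m, 1 ≤ m → H m < m) ∧
      Summable (fun m : ℕ => ((m:ℝ)+1) * (mu ν).real {w | Bad w m (H m) (R m)}) := by
  have hp0 : 0 < p := hq0.trans hqp
  obtain ⟨t, ht0, ht, hρ0, hρ1, hl⟩ := params hq0 hqp hpq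
  set l := (2*q+t)/(1+t) with hldef
  have hl0 : 0 < l := by positivity
  obtain ⟨σ, τ, ℓ, hσ, hσl, hτ0, hτ1, hℓ1, hK, hr⟩ :=
    consts (K := t⁻¹ * (l^2)⁻¹) hl0 hl (show 0 < q/p by positivity)
      (by rw [div_lt_one hp0]; exact hqp)
  obtain ⟨n, hn⟩ : ∃ n : ℕ, max (σ*l^2) (2*q*τ) < 2*q - (2*p*t)^(n+1) := by
    have h1 : 0 < 2*q - max (σ*l^2) (2*q*τ) := by
      rw [sub_pos, max_lt_iff]
      exact ⟨hσl, by nlinarith⟩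
    obtain ⟨n, hn⟩ := exists_pow_lt_of_lt_one h1 hρ1
    refine ⟨n, ?_⟩
    have := pow_le_pow_of_le_one hρ0.le hρ1.le (Nat.le_succ n)
    simp only [Nat.succ_eq_add_one] at this
    linarith
  have hβ := hn.trans_le (Ret_ge ν hp hq hq0 hqp hpq ht0 ht n)
  set β := (mu ν).real {w | Ret w (n+1)} with hβd
  have hβ1 : β ≤ 1 := measureReal_le_one
  have hβ0 : 0 < β := lt_of_le_of_lt (by positivity) hβ
  obtain ⟨hβa, hβb⟩ := max_lt_iff.1 hβ
  refine ⟨fun m => m/ℓ, fun m => ⌈(m:ℝ) * (β^(m+1))⁻¹⌉₊*((m+1)*(n+1)), ?_, ?_, ?_⟩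
  · exact Nat.tendsto_div_const_atTop (by omega)
  · exact fun m hm => Nat.div_lt_self hm (by omega)
  · set c1 : ℝ := (2*((n+1:ℕ):ℝ)+1) * β⁻¹ with hc1
    set c2 : ℝ := (2*q)⁻¹ * (τ^ℓ)⁻¹ with hc2
    have hs1 := summ_poly (r := Real.exp (-1)) (by positivity) (by rw [Real.exp_lt_one_iff]; norm_num) 1
    have hs2 := (summ_poly (r := σ*l^2/β) (by positivity) (by rw [div_lt_one hβ0]; exact hβa) 4).mul_left (c1 * l⁻¹)
    have hs3 := (summ_poly (r := 2*q*τ/β) (by positivity) (by rw [div_lt_one hβ0]; exact hβb) 3).mul_left (c1 * c2)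
    have hs := (hs1.add hs2).add hs3
    refine Summable.of_norm_bounded_eventually_nat hs ?_
    filter_upwards [eventually_ge_atTop 1] with m hm
    rw [Real.norm_eq_abs, abs_of_nonneg (by positivity)]
    have hb := bad_le ν hp hq hq0 hqp hpq ht0 ht hldef (Nat.div_lt_self hm (show 1 < ℓ by omega)) (n+1)
      (⌈(m:ℝ) * (β^(m+1))⁻¹⌉₊)
    have hF := F_term hβ0 hβ1 m
    have hR := R_term hβ0 hβ1 m (n+1)
    have hD := D_term ht0 hl0 hσ hℓ1 hK hm
    have hE := E_term hq0 hτ0 hτ1 (show 1 ≤ ℓ by omega) hr hm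
    rw [← hβd] at hb
    rw [← hc1] at hR
    rw [← hc2] at hE
    have hc10 : 0 < c1 := by positivity
    have hc20 : 0 < c2 := by positivity
    have hb2 : (mu ν).real {w | Bad w m (m/ℓ) (⌈(m:ℝ) * (β^(m+1))⁻¹⌉₊*((m+1)*(n+1)))} ≤
        (Real.exp (-1))^m + c1 * (m+1)^2 * (β^m)⁻¹ * (l⁻¹ * (m+1) * (σ*l^2)^m + c2 * (2*q*τ)^m) := by
      refine hb.trans (add_le_add hF ?_)
      have := hE
      refine mul_le_mul hR (add_le_add hD hE) (by positivity) (by positivity)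
    calc _ ≤ ((m:ℝ)+1) * ((Real.exp (-1))^m + c1 * (m+1)^2 * (β^m)⁻¹ * (l⁻¹ * (m+1) * (σ*l^2)^m + c2 * (2*q*τ)^m)) :=
        mul_le_mul_of_nonneg_left hb2 (by positivity)
      _ = _ := by
        rw [div_pow (σ*l^2), div_pow (2*q*τ)]
        exact alg_aux _ _ _ _ _ _ _ _

lemma hfin_ae (hp : ν.real {true} = p) (hq : ν.real {false} = q) (hq0 : 0 < q) (hqp : q < p)
    (hpq : p + q = 1) (m : ℕ) : ∀ᵐ w ∂(mu ν), ∃ N, A w (m+1) N ≠ ∅ := by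
  obtain ⟨t, ht0, ht, hρ0, hρ1, -⟩ := params hq0 hqp hpq
  obtain ⟨n, hn⟩ := exists_pow_lt_of_lt_one (show 0 < 2*q by positivity) hρ1
  have h1 := Ret_ge ν hp hq hq0 hqp hpq ht0 ht n
  have := pow_le_pow_of_le_one hρ0.le hρ1.le (Nat.le_succ n)
  simp only [Nat.succ_eq_add_one] at this
  have hF := badF_le ν (n+1) m
  set β := (mu ν).real {w | Ret w (n+1)} with hβd
  have hβ1 : β ≤ 1 := measureReal_le_one
  have hβ0 : 0 < β := by linarith
  have hb1 : β^(m+1) ≤ 1 := pow_le_one₀ hβ0.le hβ1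
  have hb0 : 0 < β^(m+1) := by positivity
  rw [ae_iff]
  have h2 : ∀ N, (mu ν).real {w | ¬ ∃ N, A w (m+1) N ≠ ∅} ≤ (1 - β^(m+1))^N := by
    intro N
    refine le_trans (measureReal_mono ?_) (hF N)
    intro w hw
    by_contra hc
    exact hw ⟨_, hc⟩
  have h3 : (mu ν).real {w | ¬ ∃ N, A w (m+1) N ≠ ∅} ≤ 0 :=
    ge_of_tendsto' (tendsto_pow_atTop_nhds_zero_of_lt_one (by linarith) (by linarith)) h2
  have h4 := le_antisymm h3 measureReal_nonneg
  rwa [measureReal_eq_zero_iff] at h4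
end
end GW

namespace GW

section
variable (ν : Measure Bool) [IsProbabilityMeasure ν] {p q : ℝ}

lemma C_meas {m : ℕ} (hm : 1 ≤ m) (k : ℕ) : MeasurableSet {w | C w m k} := by
  have : {w | C w m k} = ⋃ n, {w | k ≤ (A w m n).card ∧ A w (m+1) n = ∅} := by
    ext w; simp [C]
  rw [this]
  refine MeasurableSet.iUnion fun n => Dep.meas (n := n) ?_
  rintro w v h ⟨h1, h2⟩
  exact ⟨by rw [← A_congr h le_rfl hm]; exact h1, by rw [← A_congr h le_rfl (by omega)]; exact h2⟩

lemma bc {s : ℕ → Set Path} {f : ℕ → ℝ} (hf : Summable f)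
    (h : ∀ᶠ m in atTop, (mu ν).real (s m) ≤ f m) : ∀ᵐ w ∂(mu ν), ∀ᶠ m in atTop, w ∉ s m := by
  apply ae_eventually_notMem
  have h1 : Summable (fun m => (mu ν).real (s m)) := by
    refine Summable.of_norm_bounded_eventually_nat hf ?_
    filter_upwards [h] with m hm
    rwa [Real.norm_eq_abs, abs_of_nonneg measureReal_nonneg]
  have := h1.tsum_ofReal_ne_top
  simpa [ofReal_measureReal] using this

lemma upper_ae (hp : ν.real {true} = p) (hq : ν.real {false} = q) (hq0 : 0 < q) (hqp : q < p)
    (hpq : p + q = 1) {c : ℝ} (hc0 : 0 < c) (hc : c * Real.log (1-2*q) < -1) :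
    ∀ᵐ w ∂(mu ν), ∀ᶠ m : ℕ in atTop, ¬ C w m ⌈c * Real.log m⌉₊ := by
  obtain ⟨H, R, hH, hHm, hs⟩ := bad_summable ν hp hq hq0 hqp hpq
  obtain ⟨t, ht0, ht, hρ0, hρ1, -⟩ := params hq0 hqp hpq
  have ha0 : 0 < 1 - 2*q := by linarith
  have hy : Real.log (1-2*q) < -1/c := by rw [lt_div_iff₀ hc0]; linarith
  obtain ⟨y, hy1, hy2⟩ := exists_between hy
  have hyc : y * c < -1 := by rwa [lt_div_iff₀ hc0] at hy2
  have hs0 : 1 - 2*q < Real.exp y := by rwa [← Real.log_lt_iff_lt_exp ha0]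
  have hy0 : y < 0 := by nlinarith
  have h1 : ∀ᶠ m in atTop, 1 - (mu ν).real {w | Ret w (H m)} ≤ Real.exp y := by
    have h2 : Tendsto (fun n : ℕ => (2*p*t)^n) atTop (nhds 0) :=
      tendsto_pow_atTop_nhds_zero_of_lt_one hρ0.le hρ1
    have h3 := (h2.comp hH).eventually (gt_mem_nhds (show 0 < Real.exp y - (1-2*q) by linarith))
    filter_upwards [h3, hH.eventually_ge_atTop 1] with m hm hm1
    have h4 := Ret_ge ν hp hq hq0 hqp hpq ht0 ht (H m - 1)
    rw [Nat.sub_add_cancel hm1] at h4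
    simp only [Function.comp] at hm
    linarith
  have hsum := ((Real.summable_nat_rpow.2 hyc).mul_left (Real.exp (-y))).add hs
  apply bc ν hsum
  filter_upwards [h1, eventually_ge_atTop 2] with m hm hm2
  have hlog : 0 < Real.log m := Real.log_pos (by exact_mod_cast hm2)
  have hk : 0 < ⌈c * Real.log m⌉₊ := Nat.ceil_pos.2 (by positivity)
  have hk2 := Nat.le_ceil (c * Real.log m)
  obtain ⟨k, hkk⟩ : ∃ k, ⌈c * Real.log m⌉₊ = k+1 := ⟨_, (Nat.succ_pred_eq_of_pos hk).symm⟩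
  rw [hkk] at hk2 ⊢
  have hu := upper_C ν (hHm m (by omega)) (R m) k
  refine hu.trans (add_le_add ?_ ?_)
  · refine (pow_le_pow_left₀ (by have : (mu ν).real {w | Ret w (H m)} ≤ 1 := measureReal_le_one
                                 linarith) hm k).trans ?_
    rw [← Real.exp_nat_mul, Real.rpow_def_of_pos (by positivity), ← Real.exp_add, Real.exp_le_exp]
    push_cast at hk2
    nlinarith
  · have : 0 ≤ (mu ν).real {w | Bad w m (H m) (R m)} := measureReal_nonneg
    nlinarith [(Nat.cast_nonneg m : (0:ℝ) ≤ m)]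

def Jset (κ : ℕ → ℕ) (M m : ℕ) : Set Path := {w | ∀ i, M ≤ i → i < m → ¬ C w i (κ i)}

lemma Jset_dep (κ : ℕ → ℕ) {M : ℕ} (hM : 1 ≤ M) (m : ℕ) : Jdep m (Jset κ M m) := by
  rintro n w v h hA hw i hi him ⟨n', h1, h2⟩
  refine hw i hi him ?_
  have hv : A v (i+1) n ≠ ∅ := by
    rw [← A_congr h le_rfl (by omega)]
    intro he
    have := A_anti w (show 1 ≤ i+1 by omega) (show i+1 ≤ m by omega) n
    rw [he] at this
    exact hA (Finset.subset_empty.1 this)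
  have hn := le_of_empty h2 hv
  exact ⟨n', by rwa [A_congr h hn (by omega)], by rwa [A_congr h hn (by omega)]⟩

lemma lower_ae (hp : ν.real {true} = p) (hq : ν.real {false} = q) (hq0 : 0 < q) (hqp : q < p)
    (hpq : p + q = 1) {c : ℝ} (hc0 : 0 < c) (hc : -1 < c * Real.log (1-2*q)) :
    ∀ᵐ w ∂(mu ν), ∃ᶠ m : ℕ in atTop, C w m ⌈c * Real.log m⌉₊ := by
  obtain ⟨H, R, hH, hHm, hs⟩ := bad_summable ν hp hq hq0 hqp hpq
  have ha0 : 0 < 1 - 2*q := by linarith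
  have ha1 : 1 - 2*q ≤ 1 := by linarith
  have hPos := Pos_ge ν hp hq hq0 hqp hpq
  set κ : ℕ → ℕ := fun m => ⌈c * Real.log m⌉₊ with hκ
  have key : ∀ M, 2 ≤ M → ∀ᵐ w ∂(mu ν), ∃ i, M ≤ i ∧ C w i (κ i) := by
    intro M hM
    set v := (mu ν).real {w | ∀ i, M ≤ i → ¬ C w i (κ i)} with hv
    have hv0 : 0 ≤ v := measureReal_nonneg
    have hvJ : ∀ m, v ≤ (mu ν).real (Jset κ M m) := fun m =>
      measureReal_mono (fun w hw i hi _ => hw i hi)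
    have hstep : ∀ m, M ≤ m → v * (m:ℝ)^(Real.log (1-2*q) * c) ≤
        (mu ν).real (Jset κ M m) - (mu ν).real (Jset κ M (m+1)) +
          c * (((m:ℝ)+1) * (mu ν).real {w | Bad w m (H m) (R m)}) := by
      intro m hm
      have hm0 : (0:ℝ) < m := by exact_mod_cast (show 0 < m by omega)
      have hlog : 0 < Real.log m := Real.log_pos (by exact_mod_cast (show 1 < m by omega))
      have hk : 0 < κ m := Nat.ceil_pos.2 (by positivity)
      have hk2 : (κ m : ℝ) < c * Real.log m + 1 := Nat.ceil_lt_add_one (by positivity)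
      obtain ⟨k, hkk⟩ : ∃ k, κ m = k+1 := ⟨_, (Nat.succ_pred_eq_of_pos hk).symm⟩
      have hl := lower_main ν (show 1 ≤ m by omega) (H m) (R m) k (Jset_dep κ (show 1 ≤ M by omega) m)
        (hfin_ae ν hp hq hq0 hqp hpq m)
      have hsub : (⋃ n, {w | w ∈ Jset κ M m ∧ Hit w m (k+1) n ∧ Gd' w m n}) ⊆
          Jset κ M m ∩ {w | C w m (κ m)} := by
        intro w hw
        obtain ⟨n, h1, h2, -⟩ := mem_iUnion.1 hw
        exact ⟨h1, by rw [hkk]; exact (C_iff (by omega)).2 ⟨n, h2⟩⟩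
      have h1 := hl.trans (measureReal_mono hsub)
      have h2 := measureReal_inter_add_sdiff (μ := mu ν) (s := Jset κ M m) (C_meas (show 1 ≤ m by omega) (κ m))
      have h3 : (mu ν).real (Jset κ M (m+1)) ≤ (mu ν).real (Jset κ M m \ {w | C w m (κ m)}) := by
        refine measureReal_mono (fun w hw => ?_)
        exact ⟨fun i hi him => hw i hi (by omega), hw m hm (by omega)⟩
      have hkc : (k:ℝ) ≤ c * Real.log m := by rw [hkk] at hk2; push_cast at hk2; linarith
      have h4 : (m:ℝ)^(Real.log (1-2*q) * c) ≤ ((mu ν).real {w | Pos w})^k := by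
        refine le_trans ?_ (pow_le_pow_left₀ ha0.le hPos k)
        rw [Real.rpow_def_of_pos hm0, ← Real.exp_log (pow_pos ha0 k), Real.exp_le_exp, Real.log_pow]
        have : Real.log (1-2*q) ≤ 0 := Real.log_nonpos ha0.le ha1
        nlinarith
      have h5 : v * (m:ℝ)^(Real.log (1-2*q) * c) ≤ ((mu ν).real {w | Pos w})^k * (mu ν).real (Jset κ M m) := by
        rw [mul_comm]
        exact mul_le_mul h4 (hvJ m) hv0 (by positivity)
      have h6 : (k:ℝ) * (mu ν).real {w | Bad w m (H m) (R m)} ≤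
          c * (((m:ℝ)+1) * (mu ν).real {w | Bad w m (H m) (R m)}) := by
        rw [← mul_assoc]
        apply mul_le_mul_of_nonneg_right _ measureReal_nonneg
        have := Real.log_le_self hm0.le
        nlinarith
      linarith
    have hsm : Summable (fun j : ℕ => v * ((j+M:ℕ):ℝ)^(Real.log (1-2*q) * c)) := by
      have hs' := ((summable_nat_add_iff M).2 hs).mul_left c
      apply summable_of_sum_range_le (c := 1 + ∑' j, c * ((((j+M:ℕ):ℝ)+1) *
        (mu ν).real {w | Bad w (j+M) (H (j+M)) (R (j+M))}))
      · intro j; positivity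
      · intro n
        have h1 : ∑ j ∈ Finset.range n, v * ((j+M:ℕ):ℝ)^(Real.log (1-2*q) * c) ≤
            (mu ν).real (Jset κ M M) - (mu ν).real (Jset κ M (n+M)) + ∑ j ∈ Finset.range n, c * ((((j+M:ℕ):ℝ)+1) *
        (mu ν).real {w | Bad w (j+M) (H (j+M)) (R (j+M))}) := by
          induction n with
          | zero => simp
          | succ n ih =>
            rw [Finset.sum_range_succ, Finset.sum_range_succ]
            have := hstep (n+M) (by omega)
            rw [show n + 1 + M = n + M + 1 by ring]
            linarith
        have h2 : (mu ν).real (Jset κ M M) ≤ 1 := measureReal_le_one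
        have h3 : 0 ≤ (mu ν).real (Jset κ M (n+M)) := measureReal_nonneg
        have h4 := hs'.sum_le_tsum (Finset.range n) (fun i _ => by positivity)
        linarith
    have hsm2 := (summable_nat_add_iff (f := fun m : ℕ => v * (m:ℝ)^(Real.log (1-2*q) * c)) M).1 hsm
    have hv00 : v = 0 := by
      by_contra hne
      have := Real.summable_nat_rpow.1 ((summable_mul_left_iff hne).1 hsm2)
      linarith
    rw [hv, measureReal_eq_zero_iff] at hv00
    rw [ae_iff]
    convert hv00 using 4 with w
    push Not
    rfl
  have key2 : ∀ᵐ w ∂(mu ν), ∀ M, 2 ≤ M → ∃ i, M ≤ i ∧ C w i (κ i) := by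
    rw [ae_all_iff]; intro M
    by_cases hM : 2 ≤ M
    · filter_upwards [key M hM] with w hw _ using hw
    · filter_upwards with w h using absurd h hM
  filter_upwards [key2] with w hw
  rw [frequently_atTop]
  intro a
  obtain ⟨i, h1, h2⟩ := hw (max a 2) (le_max_right _ _)
  exact ⟨i, (le_max_left _ _).trans h1, h2⟩
end
end GW

namespace GW

section
variable {Ω' : Type*} {X : ℕ → Ω' → ℤ} {ω : Ω'} {w : Path}

lemma S_eq (h : ∀ i, X i ω = st (w i)) (n : ℕ) : S X n ω = W w n := by
  unfold S W
  exact Finset.sum_congr rfl fun i _ => h i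

lemma lt_eq (h : ∀ i, X i ω = st (w i)) (z : ℤ) (n : ℕ) : localTime X z n ω = L w z n := by
  unfold localTime L
  simp only [S_eq h]

lemma ncard_eq (h : ∀ i, X i ω = st (w i)) {m : ℕ} (hm : 1 ≤ m) (n : ℕ) :
    {z : ℤ | m ≤ localTime X z n ω}.ncard = (A w m n).card := by
  rw [← Set.ncard_coe_finset]
  congr 1
  ext z
  simp only [mem_ofPred_eq, Finset.mem_coe, mem_A hm, lt_eq h]

lemma hit_iff (h : ∀ i, X i ω = st (w i)) {m : ℕ} (hm : 1 ≤ m) (k n : ℕ) :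
    hitTime X m k ω ≤ (n:ℕ∞) ↔ k ≤ (A w m n).card := by
  classical
  induction k generalizing n with
  | zero => simp [hitTime]
  | succ k ih =>
    unfold hitTime
    simp only [ncard_eq h hm]
    constructor
    · intro hle
      have hne : ((fun n : ℕ => (n : ℕ∞)) ''
        {n : ℕ | hitTime X m k ω < (n : ℕ∞) ∧ (A w m n).card = k + 1}).Nonempty := by
        by_contra hc
        rw [not_nonempty_iff_eq_empty] at hc
        rw [hc, sInf_empty] at hle
        simp at hle
      obtain ⟨n', ⟨-, h2⟩, h3⟩ := csInf_mem hne
      rw [← h3] at hle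
      have hle' : n' ≤ n := by simpa using hle
      have := Finset.card_le_card (A_mono w hm hle')
      omega
    · intro hk
      have hex : ∃ n, k+1 ≤ (A w m n).card := ⟨n, hk⟩
      have hs := Nat.find_spec hex
      have hmin := fun j => Nat.find_min hex (m := j)
      have hle := Nat.find_min' hex hk
      generalize Nat.find hex = N at hs hmin hle
      have hN0 : N ≠ 0 := by rintro rfl; rw [A_zero] at hs; simp at hs
      obtain ⟨j, rfl⟩ : ∃ j, N = j+1 := ⟨N-1, by omega⟩
      have h1 := hmin j (by omega)
      have h2 := A_succ_card w hm j
      have h3 : hitTime X m k ω ≤ (j:ℕ∞) := (ih j).2 (by omega)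
      refine le_trans (sInf_le ⟨j+1, ⟨?_, by omega⟩, rfl⟩) (Nat.cast_le.2 hle)
      exact lt_of_le_of_lt h3 (by exact_mod_cast Nat.lt_succ_self j)

lemma C_link (h : ∀ i, X i ω = st (w i)) {m : ℕ} (hm : 1 ≤ m) (k : ℕ) :
    hitTime X m k ω < hitTime X (m+1) 1 ω ↔ C w m k := by
  constructor
  · intro hlt
    obtain ⟨n, hn⟩ := ENat.ne_top_iff_exists.1 hlt.ne_top
    refine ⟨n, (hit_iff h hm k n).1 hn.symm.le, ?_⟩
    have h1 : ¬ hitTime X (m+1) 1 ω ≤ (n:ℕ∞) := by rw [hn]; exact not_le.2 hlt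
    rw [hit_iff h (by omega)] at h1
    rw [← Finset.card_eq_zero]; omega
  · rintro ⟨n, h1, h2⟩
    refine lt_of_le_of_lt ((hit_iff h hm k n).2 h1) (not_le.1 ?_)
    rw [hit_iff h (by omega), h2]; simp

lemma C_anti {m k k' : ℕ} (hk : k ≤ k') (h : C w m k') : C w m k := by
  obtain ⟨n, h1, h2⟩ := h
  exact ⟨n, hk.trans h1, h2⟩

lemma C_bdd {m : ℕ} (hm : 1 ≤ m) (hN : ∃ N, A w (m+1) N ≠ ∅) : BddAbove {k | C w m k} := by
  obtain ⟨N, hN⟩ := hN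
  refine ⟨(A w m N).card, ?_⟩
  rintro k ⟨n, h1, h2⟩
  exact h1.trans (Finset.card_le_card (A_mono w hm (le_of_empty h2 hN)))

lemma G_eq (h : ∀ i, X i ω = st (w i)) {m : ℕ} (hm : 1 ≤ m) : Gcount X m ω = sSup {k | C w m k} := by
  unfold Gcount
  simp only [C_link h hm]

lemma G_ge (h : ∀ i, X i ω = st (w i)) {m k : ℕ} (hm : 1 ≤ m) (hN : ∃ N, A w (m+1) N ≠ ∅)
    (hC : C w m k) : k ≤ Gcount X m ω := by
  rw [G_eq h hm]
  exact le_csSup (C_bdd hm hN) hC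

lemma G_lt (h : ∀ i, X i ω = st (w i)) {m k : ℕ} (hm : 1 ≤ m) (hN : ∃ N, A w (m+1) N ≠ ∅)
    (hC : ¬ C w m k) : Gcount X m ω < k := by
  rw [G_eq h hm]
  have h1 : sSup {k | C w m k} ∈ {k | C w m k} :=
    Nat.sSup_mem ⟨0, 0, by simp, A_zero _ _⟩ (C_bdd hm hN)
  by_contra hc
  exact hC (C_anti (not_lt.1 hc) h1)

/-- deterministic limsup conclusion -/
lemma limsup_det {G : ℕ → ℕ} {a : ℝ} (ha0 : 0 < a) (ha1 : a < 1)
    (hu : ∀ j : ℕ, ∀ᶠ m : ℕ in atTop, G m < ⌈(-1/Real.log a + 1/((j:ℝ)+1)) * Real.log m⌉₊)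
    (hl : ∀ j : ℕ, ∃ᶠ m : ℕ in atTop, ⌈(-1/Real.log a * (1 - 1/((j:ℝ)+2))) * Real.log m⌉₊ ≤ G m) :
    limsup (fun m : ℕ => (G m : ℝ) / Real.log m) atTop = -1/Real.log a := by
  set θ := -1/Real.log a with hθ
  have hθ0 : 0 < θ := div_pos_of_neg_of_neg (by norm_num) (Real.log_neg ha0 ha1)
  have hu' : ∀ j : ℕ, ∀ᶠ m : ℕ in atTop, (G m : ℝ) / Real.log m ≤ θ + 1/((j:ℝ)+1) := by
    intro j
    filter_upwards [hu j, eventually_ge_atTop 2] with m hm hm2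
    have hlog : 0 < Real.log m := Real.log_pos (by exact_mod_cast hm2)
    rw [div_le_iff₀ hlog]
    exact (Nat.lt_ceil.1 hm).le
  have hl' : ∀ j : ℕ, ∃ᶠ m : ℕ in atTop, θ * (1 - 1/((j:ℝ)+2)) ≤ (G m : ℝ) / Real.log m := by
    intro j
    refine ((hl j).and_eventually (eventually_ge_atTop 2)).mono ?_
    rintro m ⟨hm, hm2⟩
    have hlog : 0 < Real.log m := Real.log_pos (by exact_mod_cast hm2)
    rw [le_div_iff₀ hlog]
    exact Nat.ceil_le.1 hm
  have hnn : ∀ m : ℕ, 0 ≤ (G m : ℝ) / Real.log m := fun m =>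
    div_nonneg (by positivity) (Real.log_natCast_nonneg m)
  have hb : IsBoundedUnder (· ≤ ·) atTop (fun m : ℕ => (G m : ℝ) / Real.log m) := ⟨_, hu' 0⟩
  have hcb : IsCoboundedUnder (· ≤ ·) atTop (fun m : ℕ => (G m : ℝ) / Real.log m) :=
    IsBoundedUnder.isCoboundedUnder_le ⟨0, eventually_map.2 (Eventually.of_forall hnn)⟩
  apply le_antisymm
  · have h1 : Tendsto (fun j : ℕ => θ + 1/((j:ℝ)+1)) atTop (nhds (θ + 0)) :=
      tendsto_const_nhds.add tendsto_one_div_add_atTop_nhds_zero_nat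
    rw [add_zero] at h1
    exact ge_of_tendsto' h1 fun j => limsup_le_of_le hcb (hu' j)
  · have h1 : Tendsto (fun j : ℕ => θ * (1 - 1/((j:ℝ)+2))) atTop (nhds (θ * (1 - 0))) := by
      refine tendsto_const_nhds.mul (tendsto_const_nhds.sub ?_)
      have := (tendsto_add_atTop_iff_nat 1).2 (tendsto_one_div_add_atTop_nhds_zero_nat (𝕜 := ℝ))
      refine this.congr fun j => ?_
      push_cast; ring
    rw [sub_zero, mul_one] at h1
    exact le_of_tendsto' h1 fun j => le_limsup_of_frequently_le (hl' j) hb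
end

theorem path_main (ν : Measure Bool) [IsProbabilityMeasure ν] {p q : ℝ}
    (hp : ν.real {true} = p) (hq : ν.real {false} = q) (hq0 : 0 < q) (hqp : q < p)
    (hpq : p + q = 1) : ∀ᵐ w ∂(mu ν), ∀ {Ω' : Type*} (X : ℕ → Ω' → ℤ) (ω : Ω'),
      (∀ i, X i ω = st (w i)) →
      limsup (fun m : ℕ => (Gcount X m ω : ℝ) / Real.log m) atTop = -1/Real.log (1-2*q) := by
  have ha0 : 0 < 1 - 2*q := by linarith
  have ha1 : 1 - 2*q < 1 := by linarith
  have hlog := Real.log_neg ha0 ha1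
  have hθ0 : 0 < -1/Real.log (1-2*q) := div_pos_of_neg_of_neg (by norm_num) hlog
  have hθe : -1/Real.log (1-2*q) * Real.log (1-2*q) = -1 := div_mul_cancel₀ _ hlog.ne
  have h1 := ae_all_iff.2 (hfin_ae ν hp hq hq0 hqp hpq)
  have h2 := ae_all_iff.2 fun j : ℕ => upper_ae ν hp hq hq0 hqp hpq
    (c := -1/Real.log (1-2*q) + 1/((j:ℝ)+1)) (by positivity) (by
      have : 0 < 1/((j:ℝ)+1) := by positivity
      nlinarith)
  have h3 := ae_all_iff.2 fun j : ℕ =>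
    have hj : 0 < 1/((j:ℝ)+2) := by positivity
    have hj1 : 1/((j:ℝ)+2) < 1 := by
      rw [div_lt_one (by positivity)]; linarith [(Nat.cast_nonneg j : (0:ℝ) ≤ j)]
    lower_ae ν hp hq hq0 hqp hpq
    (c := -1/Real.log (1-2*q) * (1 - 1/((j:ℝ)+2))) (mul_pos hθ0 (by linarith)) (by
      nlinarith)
  filter_upwards [h1, h2, h3] with w hw1 hw2 hw3 Ω' X ω hX
  refine limsup_det ha0 ha1 (fun j => ?_) (fun j => ?_)
  · filter_upwards [hw2 j, eventually_ge_atTop 1] with m hm hm1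
    exact G_lt hX hm1 (hw1 m) hm
  · refine ((hw3 j).and_eventually (eventually_ge_atTop 1)).mono ?_
    rintro m ⟨hm, hm1⟩
    exact G_ge hX hm1 (hw1 m) hm

end GW

/-- Almost surely, `limsup_{m→∞} G_m / log m = θ = -1/log(1-2q)`. -/
theorem limsup_Gcount
    [MeasurableSpace Ω] (P : Measure Ω) [IsProbabilityMeasure P]
    (X : ℕ → Ω → ℤ) (p q : ℝ) (hq0 : 0 < q) (hq : q < 1/2) (hpq : p + q = 1)
    (hX : IsAsymmetricSRW P X p q) :
    ∀ᵐ ω ∂P,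
      Filter.limsup (fun m : ℕ => (Gcount X m ω : ℝ) / Real.log m) atTop
        = -1 / Real.log (1 - 2*q) := by
  obtain ⟨hXm, hXi, hX1, hX2⟩ := hX
  have hp0 : 0 < p := by linarith
  have hdm : Measurable (fun z : ℤ => decide (z = 1)) := measurable_from_top
  set b : ℕ → Ω → Bool := fun i ω => decide (X i ω = 1) with hb
  have hbm : ∀ i, Measurable (b i) := fun i => hdm.comp (hXm i)
  have hbi : iIndepFun b P := hXi.comp (fun _ z => decide (z = 1)) (fun _ => hdm)
  have hst : ∀ i, ∀ᵐ ω ∂P, X i ω = GW.st (b i ω) := by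
    intro i
    have hdis : Disjoint {ω | X i ω = 1} {ω | X i ω = -1} := by
      rw [Set.disjoint_left]
      intro ω h1 h2
      simp only [mem_ofPred_eq] at h1 h2
      omega
    have hm2 : MeasurableSet {ω | X i ω = -1} := hXm i (measurableSet_singleton (-1))
    have hm1 : MeasurableSet {ω | X i ω = 1} := hXm i (measurableSet_singleton 1)
    have h1 : P ({ω | X i ω = 1} ∪ {ω | X i ω = -1}) = 1 := by
      rw [measure_union hdis hm2, hX1, hX2, ← ENNReal.ofReal_add hp0.le hq0.le, hpq, ENNReal.ofReal_one]
    have h2 := (prob_compl_eq_zero_iff (hm1.union hm2)).2 h1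
    rw [ae_iff]
    refine measure_mono_null ?_ h2
    intro ω hω hc
    apply hω
    rcases hc with hc | hc <;> simp only [mem_ofPred_eq] at hc <;> simp [hb, GW.st, hc]
  have hbt : ∀ i, P.map (b i) {true} = ENNReal.ofReal p := by
    intro i
    rw [Measure.map_apply (hbm i) (measurableSet_singleton _), ← hX1 i]
    congr 1
    ext ω
    simp [hb]
  have hpr : ∀ i, IsProbabilityMeasure (P.map (b i)) := fun i =>
    Measure.isProbabilityMeasure_map (hbm i).aemeasurable
  have hcompl : ({false} : Set Bool) = {true}ᶜ := by ext x; cases x <;> simp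
  have hbf : ∀ i, P.map (b i) {false} = ENNReal.ofReal q := by
    intro i
    rw [hcompl, prob_compl_eq_one_sub (measurableSet_singleton _), hbt, ← ENNReal.ofReal_one,
      ← ENNReal.ofReal_sub _ hp0.le]
    congr 1; linarith
  have heq : ∀ i, P.map (b i) = P.map (b 0) := by
    intro i
    refine Measure.ext_of_singleton fun x => ?_
    cases x
    · rw [hbf, hbf]
    · rw [hbt, hbt]
  have hmap : P.map (fun ω i => b i ω) = GW.mu (P.map (b 0)) := by
    rw [(iIndepFun_iff_map_fun_eq_infinitePi_map hbm).1 hbi, GW.mu]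
    congr 1
    funext i
    exact heq i
  have hmain := GW.path_main (P.map (b 0)) (p := p) (q := q)
    (by rw [measureReal_def, hbt, ENNReal.toReal_ofReal hp0.le])
    (by rw [measureReal_def, hbf, ENNReal.toReal_ofReal hq0.le]) hq0 (by linarith) hpq
  rw [← hmap] at hmain
  have hmain2 := ae_of_ae_map (measurable_pi_iff.2 hbm).aemeasurable hmain
  filter_upwards [hmain2, ae_all_iff.2 hst] with ω h1 h2
  exact h1 X ω h2
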